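/- arXiv:0911.4340 — 2 statements merged into one kernel-verified Lean document; each statement's English description precedes it below -/
import Mathlib

section
/- Let G be an n-isobicyclic group, let p be a prime dividing n, and let P be a normal Sylow p-subgroup of G. If P is nonabelian, then P is a direct factor of G; that is, there exists a normal subgroup K of G with G = P·K, P ∩ K = 1, and every element of P commuting with every element of K. -/
open scoped Pointwise

theorem aux_pow_mem {G : Type*} [Group G] (M : Subgroup G) (b : G) {j k : ℕ}
    (h : Nat.Coprime j k) (h1 : b ^ j ∈ M) (h2 : b ^ k ∈ M) : b ∈ M := by
  have h3 : b = (b ^ j) ^ (Nat.gcdA j k) * (b ^ k) ^ (Nat.gcdB j k) := by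
    rw [← zpow_natCast, ← zpow_natCast, ← zpow_mul, ← zpow_mul, ← zpow_add,
      ← Nat.gcd_eq_gcd_ab, h]
    simp
  rw [h3]
  exact M.mul_mem (M.zpow_mem h1 _) (M.zpow_mem h2 _)


theorem lemmaA {P : Type*} [Group P] [Finite P] {p : ℕ} [hp : Fact p.Prime] (hP : IsPGroup p P)
    (a b : P) (hgen : ∀ g : P, ∃ i j : ℕ, g = a ^ i * b ^ j) (φ : MulAut P) (hφa : φ a = a)
    (r s : ℕ) (hφb : φ b = a ^ r * b ^ s) (m : ℕ) (hm : φ ^ m = 1) (hcop : m.Coprime p)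
    (hs : p = 2 ∨ s ≡ 1 [MOD p]) : φ = 1 := by
  have hfin : ∀ ψ : MulAut P, ψ a = a → ψ b = b → ψ = 1 := by
    intro ψ h1 h2
    ext g
    obtain ⟨i, j, rfl⟩ := hgen g
    simp [h1, h2]
  by_cases hb : b ∈ Subgroup.zpowers a
  · obtain ⟨k, rfl⟩ := hb
    apply hfin φ hφa
    simp [hφa]
  obtain ⟨n, hn⟩ := IsPGroup.iff_card.mp hP
  obtain ⟨k, hk⟩ := IsPGroup.iff_card.mp (hP.to_subgroup (Subgroup.zpowers a))
  have hkn : k < n := by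
    have h1 : p ^ k ≤ p ^ n := by
      rw [← hk, ← hn]; exact Subgroup.card_le_card_group _
    have h2 : p ^ k ≠ p ^ n := by
      intro h
      rw [← hk, ← hn] at h
      have := Subgroup.eq_top_of_card_eq _ h
      rw [this] at hb
      exact hb trivial
    exact (Nat.pow_lt_pow_iff_right hp.out.one_lt).mp (lt_of_le_of_ne h1 h2)
  obtain ⟨M, hMc, haM⟩ := Sylow.exists_subgroup_card_pow_prime_le (G := P) (p := p) (n := k)
    (m := n - 1) (by rw [hn]; exact pow_dvd_pow _ (by omega)) (Subgroup.zpowers a) hk (by omega)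
  have haM : a ∈ M := haM (Subgroup.mem_zpowers a)
  have hidx : M.index = p := by
    have h := M.card_mul_index
    rw [hMc, hn] at h
    have h2 : p ^ n = p ^ (n - 1) * p := by rw [← pow_succ]; congr 1; omega
    rw [h2] at h
    exact Nat.eq_of_mul_eq_mul_left (pow_pos hp.out.pos _) h
  have hMn : M.Normal := by
    apply Subgroup.normal_of_index_eq_minFac_card
    rw [hidx, hn, Nat.Prime.pow_minFac hp.out (by omega)]
  have hpow : ∀ g : P, g ^ p ∈ M := by
    intro g
    have := M.pow_index_mem g
    rwa [hidx] at this
  have hbM : b ∉ M := by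
    intro h
    have : M = ⊤ := by
      rw [eq_top_iff]
      intro g _
      obtain ⟨i, j, rfl⟩ := hgen g
      exact M.mul_mem (M.pow_mem haM _) (M.pow_mem h _)
    rw [this, Subgroup.index_top] at hidx
    exact hp.out.one_lt.ne hidx
  have hj : ∀ j : ℕ, b ^ j ∈ M → p ∣ j := by
    intro j h
    by_contra hc
    exact hbM (aux_pow_mem M b ((Nat.Prime.coprime_iff_not_dvd hp.out).mpr hc) (hpow b) h)
  have hφM : ∀ c ∈ M, φ c ∈ M := by
    intro c hc
    obtain ⟨i, j, rfl⟩ := hgen c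
    have h1 : b ^ j ∈ M := (M.mul_mem_cancel_left (M.pow_mem haM _)).mp hc
    obtain ⟨t, rfl⟩ := hj j h1
    rw [map_mul, map_pow, map_pow, hφa, pow_mul]
    exact M.mul_mem (M.pow_mem haM _) (M.pow_mem (hpow _) _)
  have hφM' : ∀ c, φ c ∈ M → c ∈ M := by
    intro c hc
    have h1 : M.map φ.toMonoidHom ≤ M := by
      rintro _ ⟨d, hd, rfl⟩
      exact hφM d hd
    have h2 : M.map φ.toMonoidHom = M :=
      Subgroup.eq_of_le_of_card_ge h1 (Nat.card_congr (M.equivMapOfInjective φ.toMonoidHom φ.injective).toEquiv).le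
    rw [← h2] at hc
    obtain ⟨d, hd, he⟩ := hc
    rwa [← φ.injective he]
  have hs1 : s % p = 1 := by
    rcases hs with h | h
    · subst h
      by_contra hc
      have : 2 ∣ s := by omega
      obtain ⟨t, rfl⟩ := this
      apply hbM
      apply hφM'
      rw [hφb, pow_mul]
      exact M.mul_mem (M.pow_mem haM _) (M.pow_mem (hpow _) _)
    · rw [h, Nat.mod_eq_of_lt hp.out.one_lt]
  have hbb : b⁻¹ * φ b ∈ M := by
    have h1 : b ^ s = (b ^ p) ^ (s / p) * b := by
      rw [← pow_mul, ← pow_succ]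
      congr 1
      have := Nat.div_add_mod s p
      omega
    rw [hφb, h1, ← mul_assoc (a ^ r), ← mul_assoc]
    have := hMn.conj_mem (a ^ r * (b ^ p) ^ (s / p))
      (M.mul_mem (M.pow_mem haM _) (M.pow_mem (hpow _) _)) b⁻¹
    simpa using this
  have hX : ∀ t : ℕ, ∀ c, b⁻¹ * c ∈ M → b⁻¹ * (φ ^ t) c ∈ M := by
    intro t
    induction t with
    | zero => intro c hc; simpa using hc
    | succ t ih =>
      intro c hc
      rw [pow_succ, MulAut.mul_apply]
      apply ih
      have : b⁻¹ * φ c = b⁻¹ * φ b * φ (b⁻¹ * c) := by simp [mul_assoc]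
      rw [this]
      exact M.mul_mem hbb (hφM _ hc)
  by_contra hne
  have hord : orderOf φ ≠ 1 := by simpa using hne
  obtain ⟨q, hq, hqd⟩ := Nat.exists_prime_and_dvd hord
  have : Fact q.Prime := ⟨hq⟩
  have hqm : q ∣ m := hqd.trans (orderOf_dvd_of_pow_eq_one hm)
  have hqp : ¬ q ∣ p ^ (n - 1) := by
    intro h
    have h1 := hq.dvd_of_dvd_pow h
    have := Nat.dvd_gcd hqm h1
    rw [hcop] at this
    exact hq.one_lt.ne' (Nat.dvd_one.mp this)
  obtain ⟨t, ht⟩ := hqd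
  have hψq : (φ ^ t) ^ q = 1 := by rw [← pow_mul, mul_comm, ← ht, pow_orderOf_eq_one]
  have ht0 : 0 < t := by
    rcases Nat.eq_zero_or_pos t with h | h
    · subst h
      have := orderOf_pos φ
      omega
    · exact h
  have hψ1 : φ ^ t ≠ 1 := by
    intro h
    have h1 := Nat.le_of_dvd ht0 (orderOf_dvd_of_pow_eq_one h)
    rw [ht] at h1
    have := hq.two_le
    nlinarith
  let X := {c : P // b⁻¹ * c ∈ M}
  have hcard : Nat.card X = p ^ (n - 1) := by
    rw [← hMc]
    exact Nat.card_congr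
      ⟨fun c => ⟨b⁻¹ * c.1, c.2⟩, fun d => ⟨b * d.1, by simp⟩, fun c => by simp, fun d => by simp⟩
  have hinv : ∀ c, (φ ^ t) (((φ ^ t) ^ (q - 1)) c) = c := by
    intro c
    rw [← MulAut.mul_apply, ← pow_succ', Nat.sub_add_cancel hq.one_lt.le, hψq]; rfl
  have hinv' : ∀ c, ((φ ^ t) ^ (q - 1)) ((φ ^ t) c) = c := by
    intro c
    rw [← MulAut.mul_apply, ← pow_succ, Nat.sub_add_cancel hq.one_lt.le, hψq]; rfl
  let σ : Equiv.Perm X :=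
    ⟨fun c => ⟨(φ ^ t) c.1, hX t _ c.2⟩,
     fun c => ⟨((φ ^ t) ^ (q - 1)) c.1, by rw [← pow_mul]; exact hX _ _ c.2⟩,
     fun c => Subtype.ext (hinv' c.1), fun c => Subtype.ext (hinv c.1)⟩
  have hσ : ∀ k : ℕ, ∀ c : X, ((σ ^ k) c).1 = ((φ ^ t) ^ k) c.1 := by
    intro k
    induction k with
    | zero => intro c; rfl
    | succ k ih =>
      intro c
      rw [pow_succ, Equiv.Perm.mul_apply, ih, pow_succ, MulAut.mul_apply]
      rfl
  have : Fintype X := Fintype.ofFinite X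
  obtain ⟨c, hc⟩ := Equiv.Perm.exists_fixed_point_of_prime (p := q) (n := 1) (α := X) (σ := σ)
    (by rw [← Nat.card_eq_fintype_card, hcard]; exact hqp)
    (by
      ext c
      rw [pow_one, hσ, hψq]
      rfl)
  have hc' : (φ ^ t) c.1 = c.1 := congrArg Subtype.val hc
  have hψa : (φ ^ t) a = a := by
    clear * - hφa
    induction t with
    | zero => rfl
    | succ t ih => rw [pow_succ, MulAut.mul_apply, hφa, ih]
  obtain ⟨c, hcX⟩ := c
  obtain ⟨i, j, rfl⟩ := hgen c
  have hψb : (φ ^ t) (b ^ j) = b ^ j := by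
    simpa [hψa] using hc'
  have hjp : ¬ p ∣ j := by
    rintro ⟨l, rfl⟩
    apply hbM
    rw [pow_mul] at hcX
    have h := (M.mul_mem_cancel_right (M.mul_mem (M.pow_mem haM i) (M.pow_mem (hpow b) l))).mp hcX
    exact M.inv_mem_iff.mp h
  apply hψ1
  apply hfin _ hψa
  let F : Subgroup P := (MonoidHom.eqLocus (φ ^ t).toMonoidHom (MonoidHom.id P))
  have : b ∈ F := by
    obtain ⟨f, hf⟩ := isPGroup_iff_pow_pow_eq_one.mp hP b
    refine aux_pow_mem F b (j := p ^ f) (k := j)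
      (((Nat.Prime.coprime_iff_not_dvd hp.out).mpr hjp).pow_left f) ?_ hψb
    rw [hf]; exact F.one_mem
  exact this

theorem comm_pow_aux {G : Type*} [Group G] {x y w : G} (h : y * x = x * y * w)
    (hwx : Commute w x) (hwy : Commute w y) (i j : ℕ) :
    y ^ j * x ^ i = x ^ i * y ^ j * w ^ (i * j) := by
  have h1 : ∀ j : ℕ, y ^ j * x = x * y ^ j * w ^ j := by
    intro j
    induction j with
    | zero => simp
    | succ j ih =>
      calc y ^ (j + 1) * x = y * (y ^ j * x) := by rw [pow_succ']; group
        _ = (y * x) * y ^ j * w ^ j := by rw [ih]; group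
        _ = x * y * (w * y ^ j) * w ^ j := by rw [h]; group
        _ = x * y * (y ^ j * w) * w ^ j := by rw [(hwy.pow_right j).eq]
        _ = x * y ^ (j + 1) * w ^ (j + 1) := by rw [pow_succ' y, pow_succ' w]; group
  induction i with
  | zero => simp
  | succ i ih =>
    calc y ^ j * x ^ (i + 1) = (y ^ j * x ^ i) * x := by rw [pow_succ]; group
      _ = x ^ i * y ^ j * (w ^ (i * j) * x) := by rw [ih]; group
      _ = x ^ i * y ^ j * (x * w ^ (i * j)) := by rw [(hwx.pow_left _).eq]
      _ = x ^ i * (y ^ j * x) * w ^ (i * j) := by group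
      _ = x ^ i * (x * y ^ j * w ^ j) * w ^ (i * j) := by rw [h1]
      _ = x ^ (i + 1) * y ^ j * (w ^ j * w ^ (i * j)) := by rw [pow_succ]; group
      _ = _ := by rw [← pow_add]; congr 2; ring

theorem mul_pow_aux {G : Type*} [Group G] {x y w : G} (h : y * x = x * y * w)
    (hwx : Commute w x) (hwy : Commute w y) (n : ℕ) :
    (x * y) ^ n = x ^ n * y ^ n * w ^ (n.choose 2) := by
  induction n with
  | zero => simp
  | succ n ih =>
    have h1 := comm_pow_aux h hwx hwy 1 n
    rw [pow_one, one_mul] at h1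
    have h2 : Commute (w ^ n.choose 2) (x * y) := (hwx.mul_right hwy).pow_left _
    calc (x * y) ^ (n + 1) = x ^ n * y ^ n * (w ^ n.choose 2 * (x * y)) := by
          rw [pow_succ, ih]; group
      _ = x ^ n * (y ^ n * x) * y * w ^ n.choose 2 := by rw [h2.eq]; group
      _ = x ^ (n + 1) * y ^ n * (w ^ n * y) * w ^ n.choose 2 := by rw [h1, pow_succ]; group
      _ = x ^ (n + 1) * y ^ n * (y * w ^ n) * w ^ n.choose 2 := by rw [(hwy.pow_left n).eq]
      _ = x ^ (n + 1) * y ^ (n + 1) * (w ^ n * w ^ n.choose 2) := by rw [pow_succ y]; group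
      _ = _ := by
        rw [← pow_add, Nat.choose_succ_succ' n 1]; simp

/-- if `C ^ d = Z`, `C ^ p = 1`, `Z ≠ 1`, then `C` is a power of `Z`. -/
theorem mem_zpowers_aux {G : Type*} [Group G] {p : ℕ} (hp : p.Prime) {C Z : G} (d : ℤ)
    (h : C ^ d = Z) (hC : C ^ p = 1) (hZ : Z ≠ 1) : ∃ l : ℤ, C = Z ^ l := by
  have hd : ¬ (p : ℤ) ∣ d := by
    rintro ⟨k, rfl⟩
    rw [zpow_mul, zpow_natCast, hC, one_zpow] at h
    exact hZ h.symm
  have hcop : IsCoprime (p : ℤ) d :=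
    ((Nat.prime_iff_prime_int.mp hp).coprime_iff_not_dvd).mpr hd
  obtain ⟨e, f, hef⟩ := hcop
  refine ⟨f, ?_⟩
  calc C = C ^ (e * p + f * d) := by rw [hef, zpow_one]
    _ = Z ^ f := by
      rw [zpow_add, mul_comm e, mul_comm f, zpow_mul, zpow_mul, zpow_natCast, hC, h, one_zpow,
        one_mul]

theorem dvd_of_zpow_aux {G : Type*} [Group G] {p : ℕ} (hp : p.Prime) {C : G} (d : ℤ)
    (h : C ^ d = 1) (hC : C ^ p = 1) (hC1 : C ≠ 1) : (p : ℤ) ∣ d := by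
  rw [← orderOf_eq_prime_iff (hp := ⟨hp⟩) |>.mpr ⟨hC, hC1⟩]
  exact orderOf_dvd_iff_zpow_eq_one.mpr h

universe u

theorem lemmaB {p : ℕ} (hp : p.Prime) (hp2 : p ≠ 2) (r s n : ℕ) (hpn : ¬ p ∣ n) (N : ℕ) :
    ∀ (Γ : Type u) [Group Γ] [Finite Γ], Nat.card Γ = N →
    ∀ (P : Subgroup Γ) (_ : P.Normal) (_ : IsPGroup p P) (a b : Γ) (_ : a ∈ P) (_ : b ∈ P)
    (_ : ∀ g ∈ P, ∃ i j : ℕ, g = a ^ i * b ^ j) (u τ : Γ)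
    (_ : τ * a * τ⁻¹ = b) (_ : τ * b * τ⁻¹ = a) (_ : u * a * u⁻¹ = a)
    (_ : u * b * u⁻¹ = a ^ r * b ^ s) (_ : (τ * u * τ⁻¹ * u⁻¹) ^ n ∈ P)
    (_ : a * b ≠ b * a), (p : ℤ) ∣ s - 1 := by
  induction N using Nat.strong_induction_on with
  | _ N ih =>
  intro Γ _ _ hN P hPn hP a b ha hb hgen u τ hτa hτb hua hub hg hab
  by_contra hcon
  have : Fact p.Prime := ⟨hp⟩
  obtain ⟨z, hz⟩ : ∃ z : Γ, b * a = a * b * z := ⟨(a * b)⁻¹ * (b * a), by group⟩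
  have hz1 : z ≠ 1 := by
    rintro rfl
    exact hab (by simpa using hz.symm)
  -- minimality
  have key : ∀ M : Subgroup Γ, M.Normal → M ≤ P → M ≠ ⊥ → z ∈ M := by
    intro M hM hMP hM1
    by_contra hzM
    apply hcon
    have hcard : Nat.card (Γ ⧸ M) < N := by
      rw [← hN, M.card_eq_card_quotient_mul_card_subgroup]
      have h1 : 1 < Nat.card M := (Subgroup.one_lt_card_iff_ne_bot M).mpr hM1
      have h2 : 0 < Nat.card (Γ ⧸ M) := Nat.card_pos
      nlinarith
    let π := QuotientGroup.mk' M
    refine ih _ hcard (Γ ⧸ M) rfl (P.map π) (hPn.map π (QuotientGroup.mk'_surjective M))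
      (hP.map π) (π a) (π b) (Subgroup.mem_map_of_mem π ha) (Subgroup.mem_map_of_mem π hb) ?_
      (π u) (π τ) ?_ ?_ ?_ ?_ ?_ ?_
    · rintro _ ⟨g, hg, rfl⟩
      obtain ⟨i, j, rfl⟩ := hgen g hg
      exact ⟨i, j, by simp⟩
    · rw [← hτa]; simp
    · conv_rhs => rw [← hτb]
      simp
    · conv_rhs => rw [← hua]
      simp
    · have := congrArg π hub
      simpa using this
    · have := Subgroup.mem_map_of_mem π hg
      simpa using this
    · intro h
      apply hzM
      rw [← QuotientGroup.eq_one_iff]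
      change π z = 1
      have h2 := congrArg π hz
      rw [map_mul, map_mul, map_mul, h] at h2
      simpa using h2.symm
  -- `z` is central in `P`
  have hPnt : Nontrivial P := ⟨⟨⟨a, ha⟩, ⟨1, P.one_mem⟩, by
    intro h
    have : a = 1 := congrArg Subtype.val h
    subst this
    simp at hab⟩⟩
  let Z : Subgroup Γ := P ⊓ Subgroup.centralizer (P : Set Γ)
  have hmZ : ∀ g, g ∈ Z ↔ g ∈ P ∧ ∀ h ∈ P, h * g = g * h := by
    intro g
    simp [Z, Subgroup.mem_inf, Subgroup.mem_centralizer_iff]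
  let E : Subgroup Γ :=
    { carrier := {g | g ∈ Z ∧ g ^ p = 1}
      mul_mem' := by
        rintro g h ⟨hg1, hg2⟩ ⟨hh1, hh2⟩
        refine ⟨Z.mul_mem hg1 hh1, ?_⟩
        have : Commute g h := ((hmZ h).mp hh1).2 g ((hmZ g).mp hg1).1
        rw [this.mul_pow, hg2, hh2, one_mul]
      one_mem' := ⟨Z.one_mem, one_pow p⟩
      inv_mem' := by
        rintro g ⟨hg1, hg2⟩
        exact ⟨Z.inv_mem hg1, by rw [inv_pow, hg2, inv_one]⟩ }
  have hE : E.Normal := by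
    refine ⟨?_⟩
    rintro g ⟨hg1, hg2⟩ γ
    have hZn : Z.Normal := inferInstance
    refine ⟨hZn.conj_mem g hg1 γ, ?_⟩
    rw [conj_pow, hg2]; simp
  have hE1 : E ≠ ⊥ := by
    have h1 := hP.center_nontrivial
    have h2 : IsPGroup p (Subgroup.center P) := hP.to_subgroup _
    obtain ⟨k, hk, hk2⟩ := h2.nontrivial_iff_card.mp h1
    obtain ⟨c, hc⟩ := exists_prime_orderOf_dvd_card' (G := Subgroup.center P) p
      (by rw [hk2]; exact dvd_pow_self p hk.ne')
    have hc2 : orderOf ((c : P) : Γ) = p :=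
      (Subgroup.orderOf_coe _).trans ((Subgroup.orderOf_coe _).trans hc)
    intro hbot
    have h3 : ((c : P) : Γ) ∈ E := by
      refine ⟨(hmZ _).mpr ⟨c.1.2, ?_⟩, ?_⟩
      · intro h hh
        exact congrArg Subtype.val ((Subgroup.mem_center_iff.mp c.2) ⟨h, hh⟩)
      · conv_lhs => rw [← hc2]
        exact pow_orderOf_eq_one _
    rw [hbot, Subgroup.mem_bot] at h3
    rw [h3, orderOf_one] at hc2
    exact hp.one_lt.ne hc2
  have hzE : z ∈ E := key E hE (fun g hg => ((hmZ g).mp hg.1).1) hE1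
  have hzp : z ^ p = 1 := hzE.2
  have hzP : z ∈ P := ((hmZ z).mp hzE.1).1
  have hzc : ∀ g ∈ P, Commute z g := fun g hg => (((hmZ z).mp hzE.1).2 g hg).symm
  have hza := hzc a ha
  have hzb := hzc b hb
  have hzk : ∀ k : ℕ, p ∣ k → z ^ k = 1 := by
    rintro _ ⟨k, rfl⟩
    rw [pow_mul, hzp, one_pow]
  have hzk' : ∀ k : ℕ, z ^ k = 1 → p ∣ k := by
    intro k hk
    have := dvd_of_zpow_aux hp (k : ℤ) (by rwa [zpow_natCast]) hzp hz1
    exact_mod_cast this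
  have hcomm : ∀ i j : ℕ, b ^ j * a ^ i = a ^ i * b ^ j * z ^ (i * j) :=
    comm_pow_aux hz hza hzb
  -- power formula
  have hpw : ∀ i j k : ℕ, p ∣ k → (a ^ i * b ^ j) ^ k = (a ^ k) ^ i * (b ^ k) ^ j := by
    intro i j k hk
    have h := mul_pow_aux (hcomm i j) ((hza.pow_left _).pow_right i) ((hzb.pow_left _).pow_right j) k
    have h2 : p ∣ k.choose 2 := by
      have h3 : k.choose 2 * 2 = k * (k - 1) := by
        rw [Nat.choose_two_right]
        exact Nat.div_mul_cancel (Nat.even_mul_pred_self k).two_dvd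
      have h4 : p ∣ k.choose 2 * 2 := by rw [h3]; exact hk.mul_right _
      rcases hp.dvd_mul.mp h4 with h5 | h5
      · exact h5
      · exact absurd ((Nat.prime_dvd_prime_iff_eq hp Nat.prime_two).mp h5) hp2
    rw [h, ← pow_mul z, hzk _ (h2.mul_left _), mul_one, ← pow_mul, ← pow_mul, ← pow_mul, ← pow_mul,
      mul_comm i, mul_comm j]
  have hτpow : ∀ k : ℕ, τ * a ^ k * τ⁻¹ = b ^ k := by
    intro k; rw [← conj_pow, hτa]
  have hτpow' : ∀ k : ℕ, τ * b ^ k * τ⁻¹ = a ^ k := by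
    intro k; rw [← conj_pow, hτb]
  -- the order of `a` is at least `p ^ 2`
  have hap : a ^ p ≠ 1 := by
    intro h
    have h' : b ^ p = 1 := by rw [← hτpow, h]; simp
    obtain ⟨i, j, hij⟩ := hgen z hzP
    apply hz1
    have h1 : b ^ 1 * a ^ i = a ^ i * b ^ 1 := by
      have e : a ^ i = z * (b ^ j)⁻¹ := by rw [hij]; group
      have : Commute b (a ^ i) := by
        rw [e]
        exact hzb.symm.mul_right ((Commute.refl b).pow_right j).inv_right
      simpa using this.eq
    have h2 : b ^ j * a ^ 1 = a ^ 1 * b ^ j := by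
      have e : b ^ j = (a ^ i)⁻¹ * z := by rw [hij]; group
      have : Commute a (b ^ j) := by
        rw [e]
        exact ((Commute.refl a).pow_right i).inv_right.mul_right hza.symm
      simpa using this.eq.symm
    rw [hcomm] at h1 h2
    obtain ⟨i', rfl⟩ := hzk' i (by simpa using h1)
    obtain ⟨j', rfl⟩ := hzk' j (by simpa using h2)
    rw [hij, pow_mul, pow_mul, h, h']; simp
  obtain ⟨e, he⟩ : ∃ e : ℕ, orderOf a = p ^ e := by
    obtain ⟨e, he⟩ := (IsPGroup.iff_orderOf.mp hP) ⟨a, ha⟩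
    exact ⟨e, by rw [← he]; simp⟩
  have he2 : 2 ≤ e := by
    by_contra hlt
    apply hap
    apply orderOf_dvd_iff_pow_eq_one.mp
    rw [he]
    conv_rhs => rw [← pow_one p]
    exact pow_dvd_pow p (by omega)
  obtain ⟨q, hq⟩ : ∃ q, q = p ^ (e - 1) := ⟨_, rfl⟩
  have hpq : p ∣ q := by rw [hq]; exact dvd_pow_self p (by omega)
  have hqp : q * p = p ^ e := by rw [hq, ← pow_succ]; congr 1; omega
  obtain ⟨A, hA⟩ : ∃ A, A = a ^ q := ⟨_, rfl⟩
  obtain ⟨B, hB⟩ : ∃ B, B = b ^ q := ⟨_, rfl⟩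
  have hAp : A ^ p = 1 := by rw [hA, ← pow_mul, hqp, ← he, pow_orderOf_eq_one]
  have hA1 : A ≠ 1 := by
    rw [hA]
    intro h
    have h1 := orderOf_dvd_of_pow_eq_one h
    rw [he, hq, Nat.pow_dvd_pow_iff_le_right hp.one_lt] at h1
    omega
  have hτA : τ * A * τ⁻¹ = B := by rw [hA, hB, hτpow]
  have hτB : τ * B * τ⁻¹ = A := by rw [hA, hB, hτpow']
  have hBp : B ^ p = 1 := by rw [← hτA, conj_pow, hAp]; simp
  have hAb : Commute A b := by
    have := hcomm q 1
    rw [hzk _ (hpq.mul_right 1), mul_one, pow_one, ← hA] at this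
    exact this.symm
  have hBa : Commute B a := by
    have := hcomm 1 q
    rw [hzk _ (hpq.mul_left 1), mul_one, pow_one, ← hB] at this
    exact this
  have hAa : Commute A a := by rw [hA]; exact (Commute.refl a).pow_left q
  have hBb : Commute B b := by rw [hB]; exact (Commute.refl b).pow_left q
  have hAc : ∀ g ∈ P, Commute A g := by
    intro g hg
    obtain ⟨i, j, rfl⟩ := hgen g hg
    exact (hAa.pow_right i).mul_right (hAb.pow_right j)
  have hAP : A ∈ P := by rw [hA]; exact P.pow_mem ha q
  have hBP : B ∈ P := by rw [hB]; exact P.pow_mem hb q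
  have hAB : Commute A B := hAc B hBP
  -- the subgroup generated by `A, B`
  let W : Subgroup Γ :=
    { carrier := {g | ∃ i j : ℤ, g = A ^ i * B ^ j}
      mul_mem' := by
        rintro _ _ ⟨i, j, rfl⟩ ⟨i', j', rfl⟩
        refine ⟨i + i', j + j', ?_⟩
        have := (hAB.zpow_zpow i' j).eq
        rw [zpow_add, zpow_add]
        calc _ = A ^ i * (B ^ j * A ^ i') * B ^ j' := by group
          _ = _ := by rw [← this]; group
      one_mem' := ⟨0, 0, by simp⟩
      inv_mem' := by
        rintro _ ⟨i, j, rfl⟩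
        refine ⟨-i, -j, ?_⟩
        have := (hAB.zpow_zpow (-i) (-j)).eq
        rw [this]; group }
  have hWconj : ∀ γ : Γ, ∀ c ∈ P, γ * c ^ q * γ⁻¹ ∈ W := by
    intro γ c hc
    rw [← conj_pow]
    obtain ⟨i, j, hij⟩ := hgen _ (hPn.conj_mem c hc γ)
    rw [hij, hpw i j q hpq, ← hA, ← hB]
    exact ⟨i, j, by simp⟩
  have hW : W.Normal := by
    refine ⟨?_⟩
    rintro _ ⟨i, j, rfl⟩ γ
    have : γ * (A ^ i * B ^ j) * γ⁻¹ = (γ * A * γ⁻¹) ^ i * (γ * B * γ⁻¹) ^ j := by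
      rw [conj_zpow, conj_zpow]; group
    rw [this, hA, hB]
    exact W.mul_mem (W.zpow_mem (hWconj γ a ha) i) (W.zpow_mem (hWconj γ b hb) j)
  have hWP : W ≤ P := by
    rintro _ ⟨i, j, rfl⟩
    exact P.mul_mem (P.zpow_mem hAP i) (P.zpow_mem hBP j)
  have hW1 : W ≠ ⊥ := by
    intro h
    have : A ∈ W := ⟨1, 0, by simp⟩
    rw [h, Subgroup.mem_bot] at this
    exact hA1 this
  obtain ⟨i, j, hzW⟩ := key W hW hWP hW1
  -- conjugation of `z`
  have hτz : τ * z * τ⁻¹ = z⁻¹ := by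
    have h1 : τ * (b * a) * τ⁻¹ = τ * (a * b * z) * τ⁻¹ := by rw [hz]
    have h2 : τ * (b * a) * τ⁻¹ = (τ * b * τ⁻¹) * (τ * a * τ⁻¹) := by group
    have h3 : τ * (a * b * z) * τ⁻¹ = (τ * a * τ⁻¹) * (τ * b * τ⁻¹) * (τ * z * τ⁻¹) := by group
    rw [h2, h3, hτa, hτb, hz] at h1
    have h4 : a * b * (z * (τ * z * τ⁻¹)) = a * b * 1 := by
      rw [mul_one]; conv_rhs => rw [h1]
      group
    exact eq_inv_of_mul_eq_one_right (mul_left_cancel h4)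
  have huz : u * z * u⁻¹ = z ^ s := by
    have h1 : u * (b * a) * u⁻¹ = u * (a * b * z) * u⁻¹ := by rw [hz]
    have h2 : u * (b * a) * u⁻¹ = (u * b * u⁻¹) * (u * a * u⁻¹) := by group
    have h3 : u * (a * b * z) * u⁻¹ = (u * a * u⁻¹) * (u * b * u⁻¹) * (u * z * u⁻¹) := by group
    rw [h2, h3, hua, hub] at h1
    have h5 := hcomm 1 s
    rw [pow_one, one_mul] at h5
    have h6 : a ^ r * b ^ s * a = a * (a ^ r * b ^ s) * z ^ s := by
      rw [mul_assoc, h5]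
      have := ((Commute.refl a).pow_right r).eq
      calc a ^ r * (a * b ^ s * z ^ s) = (a ^ r * a) * b ^ s * z ^ s := by group
        _ = _ := by rw [← this]; group
    rw [h6] at h1
    exact (mul_left_cancel h1).symm
  obtain ⟨v, hv⟩ : ∃ v, v = τ * u * τ⁻¹ := ⟨_, rfl⟩
  have hvz : v * z * v⁻¹ = z ^ s := by
    have h1 : τ⁻¹ * z * τ = z⁻¹ := by
      have : z = τ⁻¹ * (τ * z * τ⁻¹) * τ := by group
      rw [hτz] at this
      have h2 : z⁻¹ = (τ⁻¹ * z⁻¹ * τ)⁻¹ := congrArg _ this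
      rw [h2]; group
    calc v * z * v⁻¹ = τ * (u * (τ⁻¹ * z * τ) * u⁻¹) * τ⁻¹ := by rw [hv]; group
      _ = τ * (u * z * u⁻¹)⁻¹ * τ⁻¹ := by rw [h1]; group
      _ = ((τ * z * τ⁻¹) ^ s)⁻¹ := by rw [huz, conj_pow]; group
      _ = z ^ s := by rw [hτz, inv_pow, inv_inv]
  -- `C = A * B⁻¹`
  obtain ⟨C, hC⟩ : ∃ C, C = A * B⁻¹ := ⟨_, rfl⟩
  have hCz2 : C ^ (i - j) = z ^ 2 := by
    have h1 : z⁻¹ = B ^ i * A ^ j := by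
      rw [← hτz, hzW]
      have : τ * (A ^ i * B ^ j) * τ⁻¹ = (τ * A * τ⁻¹) ^ i * (τ * B * τ⁻¹) ^ j := by
        rw [conj_zpow, conj_zpow]; group
      rw [this, hτA, hτB]
    have h2 : z = A ^ (-j) * B ^ (-i) := by
      rw [← inv_inv z, h1]; group
    have hzz : z ^ 2 = (A ^ (-j) * B ^ (-i)) * (A ^ i * B ^ j) := by rw [pow_two, ← h2, ← hzW]
    rw [hC, hAB.inv_right.mul_zpow, hzz]
    have := (hAB.zpow_zpow i (-i)).eq
    have h3 := (hAB.zpow_zpow (i - j) (j - i)).eq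
    rw [inv_zpow', neg_sub]
    calc A ^ (i - j) * B ^ (j - i) = A ^ (-j) * (A ^ i * B ^ (-i)) * B ^ j := by group
      _ = _ := by rw [this]; group
  have hCp : C ^ p = 1 := by rw [hC, hAB.inv_right.mul_pow, inv_pow, hAp, hBp]; simp
  have hz2 : z ^ 2 ≠ 1 := by
    intro h
    exact hp2 ((Nat.prime_dvd_prime_iff_eq hp Nat.prime_two).mp (hzk' 2 h))
  have hC1 : C ≠ 1 := by
    intro h
    rw [h, one_zpow] at hCz2
    exact hz2 hCz2.symm
  obtain ⟨l, hl⟩ : ∃ l : ℤ, C = z ^ l := by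
    obtain ⟨l, hl⟩ := mem_zpowers_aux hp _ hCz2 hCp hz2
    exact ⟨2 * l, by rw [hl, zpow_mul]; norm_cast⟩
  have huC : u * C * u⁻¹ = C ^ s := by
    rw [hl, ← conj_zpow, huz, ← zpow_natCast, ← zpow_natCast, ← zpow_mul, ← zpow_mul, mul_comm]
  have hvC : v * C * v⁻¹ = C ^ s := by
    rw [hl, ← conj_zpow, hvz, ← zpow_natCast, ← zpow_natCast, ← zpow_mul, ← zpow_mul, mul_comm]
  have huA : u * A * u⁻¹ = A := by rw [hA, ← conj_pow, hua]
  have huB : u * B * u⁻¹ = A ^ r * B ^ s := by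
    rw [hB, ← conj_pow, hub, hpw r s q hpq, hA]
  have hrs : A ^ (1 - r - s : ℤ) = 1 := by
    have h1 : u * C * u⁻¹ = (u * A * u⁻¹) * (u * B * u⁻¹)⁻¹ := by rw [hC]; group
    rw [huC, huA, huB, hC, hAB.inv_right.mul_pow] at h1
    have h2 : A ^ s * (B⁻¹) ^ s * B ^ s = A * (A ^ r * B ^ s)⁻¹ * B ^ s := by rw [h1]
    have h3 : A ^ s = A * (A ^ r)⁻¹ := by
      calc A ^ s = A ^ s * (B⁻¹) ^ s * B ^ s := by rw [inv_pow]; group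
        _ = _ := by
          rw [h2, (hAB.pow_pow r s).eq]; group
    rw [sub_eq_add_neg, zpow_add, zpow_neg, zpow_natCast, sub_eq_add_neg, zpow_add, zpow_one,
      zpow_neg, zpow_natCast, ← h3]
    simp
  have hdvd : (p : ℤ) ∣ 1 - r - s := dvd_of_zpow_aux hp _ hrs hAp hA1
  have hvA : v * A * v⁻¹ = A * (C ^ r)⁻¹ := by
    calc v * A * v⁻¹ = τ * (u * (τ⁻¹ * A * τ) * u⁻¹) * τ⁻¹ := by rw [hv]; group
      _ = τ * (u * B * u⁻¹) * τ⁻¹ := by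
        rw [← hτB]; group
      _ = (τ * A * τ⁻¹) ^ r * (τ * B * τ⁻¹) ^ s := by rw [huB, conj_pow, conj_pow]; group
      _ = B ^ r * A ^ s := by rw [hτA, hτB]
      _ = B ^ r * (A ^ (1 - r - s : ℤ) * A ^ s) := by rw [hrs, one_mul]
      _ = B ^ r * (A ^ r)⁻¹ * A := by
        rw [← zpow_natCast, ← zpow_natCast, ← zpow_natCast, ← zpow_add]
        have : (1 - r - s + s : ℤ) = - r + 1 := by ring
        rw [this, zpow_add]; group
      _ = (C ^ r)⁻¹ * A := by rw [hC, hAB.inv_right.mul_pow]; simp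
      _ = A * (C ^ r)⁻¹ := by
        have : Commute A C := by rw [hC]; exact (Commute.refl A).mul_right hAB.inv_right
        rw [(this.pow_right r).inv_right.eq]
  -- final
  obtain ⟨g, hgd⟩ : ∃ g, g = v * u⁻¹ := ⟨_, rfl⟩
  have hgn : g ^ n ∈ P := by rw [hgd, hv]; exact hg
  have hgA : g * A * g⁻¹ = A * (C ^ r)⁻¹ := by
    rw [← hvA, hgd]
    conv_rhs => rw [← huA]
    conv_lhs => rw [← huA]
    have : u⁻¹ * A * u = A := by
      conv_lhs => rw [← huA]
      group
    calc _ = v * A * v⁻¹ := by group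
      _ = _ := by rw [huA]
  have hCs1 : C ^ s ≠ 1 := by
    rw [← huC]
    intro h
    exact hC1 (conj_eq_one_iff.mp h)
  have hgCs : Commute g (C ^ s) := by
    have : g * C ^ s * g⁻¹ = C ^ s := by
      conv_lhs => rw [← huC]
      rw [← hvC, hgd]; group
    exact mul_inv_eq_iff_eq_mul.mp this
  have hgC : Commute g C := by
    obtain ⟨l', hl'⟩ := mem_zpowers_aux hp (s : ℤ) (zpow_natCast C s) hCp hCs1
    rw [hl']
    exact hgCs.zpow_right l'
  have hgk : ∀ k : ℕ, g ^ k * A * (g ^ k)⁻¹ = A * ((C ^ r)⁻¹) ^ k := by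
    intro k
    induction k with
    | zero => simp
    | succ k ihk =>
      have h1 : Commute g (((C ^ r)⁻¹) ^ k) := ((hgC.pow_right r).inv_right).pow_right k
      calc g ^ (k + 1) * A * (g ^ (k + 1))⁻¹ = g * (g ^ k * A * (g ^ k)⁻¹) * g⁻¹ := by
            rw [pow_succ']; group
        _ = (g * A * g⁻¹) * (g * ((C ^ r)⁻¹) ^ k * g⁻¹) := by rw [ihk]; group
        _ = A * (C ^ r)⁻¹ * ((C ^ r)⁻¹) ^ k := by
          rw [hgA, h1.eq, mul_inv_cancel_right]
        _ = _ := by rw [pow_succ', mul_assoc]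
  have hfin : C ^ (r * n) = 1 := by
    have h1 := hgk n
    rw [← (hAc _ hgn).eq, mul_inv_cancel_right] at h1
    have h2 : ((C ^ r)⁻¹) ^ n = 1 := by
      have h3 : A * 1 = A * ((C ^ r)⁻¹) ^ n := by rw [mul_one]; exact h1
      exact (mul_left_cancel h3).symm
    rw [inv_pow, inv_eq_one] at h2
    rw [pow_mul]; exact h2
  have hrn : p ∣ r * n := by
    have := dvd_of_zpow_aux hp ((r * n : ℕ) : ℤ) (by rw [zpow_natCast]; exact hfin) hCp hC1
    exact_mod_cast this
  have hr : (p : ℤ) ∣ r := by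
    have := (hp.dvd_mul.mp hrn).resolve_right hpn
    exact_mod_cast this
  apply hcon
  have : (s - 1 : ℤ) = -(1 - r - s) - r := by ring
  rw [this]
  exact dvd_sub (dvd_neg.mpr hdvd) hr

theorem pow_card_of_mem_aux {G : Type*} [Group G] {H : Subgroup G} {g : G}
    (hg : g ∈ H) : g ^ Nat.card H = 1 := by
  have h : (⟨g, hg⟩ : H) ^ Nat.card H = 1 := pow_card_eq_one'
  exact congrArg Subtype.val h

theorem exists_pow_of_mem_aux {G : Type*} [Group G] [Finite G] {a g : G}
    (hg : g ∈ Subgroup.zpowers a) : ∃ i : ℕ, a ^ i = g :=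
  mem_powers_iff_mem_zpowers.mpr hg

theorem finish_aux {G : Type*} [Group G] [Finite G] {p : ℕ} (hp : p.Prime)
    (P : Sylow p G) (hPn : (P : Subgroup G).Normal)
    (hsup : (P : Subgroup G) ⊔ Subgroup.centralizer ((P : Subgroup G) : Set G) = ⊤) :
    ∃ K : Subgroup G, K.Normal ∧
      (((P : Subgroup G) : Set G) * (K : Set G) = Set.univ) ∧
      (P : Subgroup G) ⊓ K = ⊥ ∧
      ∀ a ∈ (P : Subgroup G), ∀ b ∈ K, a * b = b * a := by
  have : Fact p.Prime := ⟨hp⟩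
  obtain ⟨K, hK⟩ := Subgroup.exists_right_complement'_of_coprime (N := (P : Subgroup G))
    P.card_coprime_index
  have hKc : ∀ k ∈ K, k ∈ Subgroup.centralizer ((P : Subgroup G) : Set G) := by
    intro k hk
    have h1 : k ∈ (P : Subgroup G) ⊔ Subgroup.centralizer ((P : Subgroup G) : Set G) := by
      rw [hsup]; trivial
    obtain ⟨q, hq, c, hc, rfl⟩ := Subgroup.mem_sup_of_normal_left.mp h1
    refine Subgroup.mul_mem _ ?_ hc
    have hcomm : Commute q c := (Subgroup.mem_centralizer_iff.mp hc) q hq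
    have h2 : (q * c) ^ (Nat.card K) = 1 := pow_card_of_mem_aux hk
    rw [hcomm.mul_pow] at h2
    refine aux_pow_mem _ q (j := Nat.card (P : Subgroup G)) (k := Nat.card K) ?_ ?_ ?_
    · have h3 := P.card_coprime_index
      rwa [hK.symm.index_eq_card] at h3
    · have : q ^ Nat.card (P : Subgroup G) = 1 := pow_card_of_mem_aux hq
      rw [this]; exact Subgroup.one_mem _
    · rw [eq_inv_of_mul_eq_one_left h2]
      exact Subgroup.inv_mem _ (Subgroup.pow_mem _ hc _)
  have hKc' : ∀ a ∈ (P : Subgroup G), ∀ b ∈ K, a * b = b * a := fun a ha b hb =>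
    (Subgroup.mem_centralizer_iff.mp (hKc b hb)) a ha
  have huniv := hK.mul_eq
  refine ⟨K, ⟨?_⟩, huniv, hK.disjoint.eq_bot, hKc'⟩
  intro k hk g
  obtain ⟨q, hq, k', hk', rfl⟩ : g ∈ (((P : Subgroup G) : Set G) * (K : Set G)) := by
    rw [huniv]; trivial
  have h1 : k' * k * k'⁻¹ ∈ K := K.mul_mem (K.mul_mem hk' hk) (K.inv_mem hk')
  have h2 : q * k' * k * (q * k')⁻¹ = k' * k * k'⁻¹ := by
    calc q * k' * k * (q * k')⁻¹ = q * (k' * k * k'⁻¹) * q⁻¹ := by group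
      _ = _ := by rw [hKc' q hq _ h1, mul_inv_cancel_right]
  change q * k' * k * (q * k')⁻¹ ∈ K
  rw [h2]; exact h1

theorem mem_of_order_aux {G : Type*} [Group G] [Finite G] {p : ℕ} (hp : p.Prime)
    (P : Sylow p G) (hPn : (P : Subgroup G).Normal) (a : G) (e : ℕ) (ha : a ^ p ^ e = 1) :
    a ∈ (P : Subgroup G) := by
  have : Fact p.Prime := ⟨hp⟩
  refine aux_pow_mem _ a (j := p ^ e) (k := (P : Subgroup G).index) ?_ ?_ ?_
  · exact ((Nat.Prime.coprime_iff_not_dvd hp).mpr P.not_dvd_index).pow_left e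
  · rw [ha]; exact Subgroup.one_mem _
  · exact Subgroup.pow_index_mem _ a

/-- Proposition 6.1. If `G` is `n`-isobicyclic and `P` is a nonabelian
normal Sylow `p`-subgroup of `G`, then `P` is a direct factor of `G`: there is a normal
subgroup `K` with `G = P·K`, `P ∩ K = 1`, and `P` and `K` commuting elementwise. -/
theorem nonabelian_normal_sylow_is_direct_factor
    {G : Type*} [Group G] [Finite G] (n : ℕ) (hn : 0 < n) (x y : G)
    (hx : orderOf x = n) (hy : orderOf y = n)
    (hprod : (↑(Subgroup.zpowers x) * ↑(Subgroup.zpowers y) : Set G) = Set.univ)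
    (hinter : Subgroup.zpowers x ⊓ Subgroup.zpowers y = ⊥)
    (α : G ≃* G) (hαx : α x = y) (hαy : α y = x)
    (p : ℕ) (hp : p.Prime) (hpn : p ∣ n)
    (P : Sylow p G) (hPnormal : (P : Subgroup G).Normal)
    (hPnab : ¬ ∀ a ∈ (P : Subgroup G), ∀ b ∈ (P : Subgroup G), a * b = b * a) :
    ∃ K : Subgroup G, K.Normal ∧
      (((P : Subgroup G) : Set G) * (K : Set G) = Set.univ) ∧
      (P : Subgroup G) ⊓ K = ⊥ ∧
      ∀ a ∈ (P : Subgroup G), ∀ b ∈ K, a * b = b * a := by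
  have hfact : Fact p.Prime := ⟨hp⟩
  apply finish_aux hp P hPnormal
  obtain ⟨e, m, hpm, hnm⟩ := Nat.exists_eq_pow_mul_and_not_dvd hn.ne' p hp.ne_one
  have hm0 : 0 < m := Nat.pos_of_ne_zero (by rintro rfl; simp at hpm)
  have hcop : Nat.Coprime m (p ^ e) :=
    (((Nat.Prime.coprime_iff_not_dvd hp).mpr hpm).pow_left e).symm
  have hcardG : Nat.card G = n * n := by
    have h := Subgroup.isComplement'_of_disjoint_and_mul_eq_univ
      (disjoint_iff.mpr hinter) hprod
    have h2 := h.card_mul_card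
    rw [Nat.card_zpowers, Nat.card_zpowers, hx, hy] at h2
    exact h2.symm
  have hcardP : Nat.card (P : Subgroup G) = p ^ e * p ^ e := by
    have h := P.card_eq_multiplicity
    rw [hcardG, Nat.factorization_mul hn.ne' hn.ne'] at h
    have h2 : n.factorization p = e := by
      rw [hnm, Nat.factorization_mul (pow_pos hp.pos e).ne' hm0.ne', Finsupp.add_apply,
        hp.factorization_pow, Nat.factorization_eq_zero_of_not_dvd hpm]
      simp
    rw [Finsupp.add_apply, h2, pow_add] at h
    exact h
  obtain ⟨a, hadef⟩ : ∃ a, a = x ^ m := ⟨_, rfl⟩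
  obtain ⟨b, hbdef⟩ : ∃ b, b = y ^ m := ⟨_, rfl⟩
  obtain ⟨u, hudef⟩ : ∃ u, u = x ^ p ^ e := ⟨_, rfl⟩
  obtain ⟨v, hvdef⟩ : ∃ v, v = y ^ p ^ e := ⟨_, rfl⟩
  have hαa : α a = b := by rw [hadef, map_pow, hαx, hbdef]
  have hαb : α b = a := by rw [hbdef, map_pow, hαy, hadef]
  have hαu : α u = v := by rw [hudef, map_pow, hαx, hvdef]
  have hordx : x ^ n = 1 := by rw [← hx]; exact pow_orderOf_eq_one x
  have hoa : orderOf a = p ^ e := by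
    rw [hadef, orderOf_pow_of_dvd hm0.ne' (by rw [hx, hnm]; exact dvd_mul_left _ _), hx, hnm,
      Nat.mul_div_cancel _ hm0]
  have hob : orderOf b = p ^ e := by
    rw [hbdef, orderOf_pow_of_dvd hm0.ne' (by rw [hy, hnm]; exact dvd_mul_left _ _), hy, hnm,
      Nat.mul_div_cancel _ hm0]
  have hum : u ^ m = 1 := by rw [hudef, ← pow_mul, ← hnm, hordx]
  have haP : a ∈ (P : Subgroup G) :=
    mem_of_order_aux hp P hPnormal a e (by rw [← hoa]; exact pow_orderOf_eq_one a)
  have hbP : b ∈ (P : Subgroup G) :=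
    mem_of_order_aux hp P hPnormal b e (by rw [← hob]; exact pow_orderOf_eq_one b)
  have hua : Commute u a := by
    rw [hudef, hadef]; exact (Commute.refl x).pow_pow _ _
  -- `P = ⟨a⟩⟨b⟩`
  have hgen' : ∀ g : (P : Subgroup G), ∃ i j : ℕ,
      g = (⟨a, haP⟩ : (P : Subgroup G)) ^ i * (⟨b, hbP⟩ : (P : Subgroup G)) ^ j := by
    have hd : Disjoint (Subgroup.zpowers (⟨a, haP⟩ : (P : Subgroup G)))
        (Subgroup.zpowers (⟨b, hbP⟩ : (P : Subgroup G))) := by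
      rw [disjoint_iff, eq_bot_iff]
      rintro g ⟨⟨i, hi⟩, ⟨j, hj⟩⟩
      have h1 : (g : G) ∈ Subgroup.zpowers x ⊓ Subgroup.zpowers y := by
        constructor
        · rw [← hi]
          simp only [Subgroup.coe_zpow, hadef]
          exact Subgroup.zpow_mem _ (Subgroup.pow_mem _ (Subgroup.mem_zpowers x) _) _
        · rw [← hj]
          simp only [Subgroup.coe_zpow, hbdef]
          exact Subgroup.zpow_mem _ (Subgroup.pow_mem _ (Subgroup.mem_zpowers y) _) _
      rw [hinter, Subgroup.mem_bot] at h1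
      rw [Subgroup.mem_bot]
      exact Subtype.ext h1
    have hc := Subgroup.isComplement'_of_card_mul_and_disjoint (by
      rw [Nat.card_zpowers, Nat.card_zpowers, Subgroup.orderOf_mk, Subgroup.orderOf_mk, hoa, hob]
      exact hcardP.symm) hd
    intro g
    have hg : g ∈ ((Subgroup.zpowers (⟨a, haP⟩ : (P : Subgroup G)) : Set (P : Subgroup G)) *
        (Subgroup.zpowers (⟨b, hbP⟩ : (P : Subgroup G)) : Set (P : Subgroup G))) := by
      rw [hc.mul_eq]; trivial
    obtain ⟨g1, h1, g2, h2, rfl⟩ := hg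
    obtain ⟨i, hi⟩ := exists_pow_of_mem_aux h1
    obtain ⟨j, hj⟩ := exists_pow_of_mem_aux h2
    exact ⟨i, j, by simp [hi, hj]⟩
  have hgen : ∀ g ∈ (P : Subgroup G), ∃ i j : ℕ, g = a ^ i * b ^ j := by
    intro g hg
    obtain ⟨i, j, h⟩ := hgen' ⟨g, hg⟩
    exact ⟨i, j, by simpa using congrArg Subtype.val h⟩
  have hab : a * b ≠ b * a := by
    intro h
    have hc : Commute a b := h
    apply hPnab
    intro g hg g' hg'
    obtain ⟨i, j, rfl⟩ := hgen g hg
    obtain ⟨i', j', rfl⟩ := hgen g' hg'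
    have h1 : Commute a (a ^ i' * b ^ j') :=
      ((Commute.refl a).pow_right _).mul_right (hc.pow_right _)
    have h2 : Commute b (a ^ i' * b ^ j') :=
      (hc.symm.pow_right _).mul_right ((Commute.refl b).pow_right _)
    exact ((h1.pow_left i).mul_left (h2.pow_left j)).eq
  obtain ⟨r, s, hrs⟩ := hgen _ (hPnormal.conj_mem b hbP u)
  have hs : p = 2 ∨ s ≡ 1 [MOD p] := by
    by_cases hp2 : p = 2
    · exact Or.inl hp2
    right
    have hchar : (P : Subgroup G).Characteristic := P.characteristic_of_normal hPnormal
    let Γ := G ⋊[MonoidHom.id (MulAut G)] (MulAut G)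
    let ι : G →* Γ := SemidirectProduct.inl
    let τ : Γ := SemidirectProduct.inr α
    have : Finite Γ := Finite.of_equiv _ (SemidirectProduct.equivProd).symm
    have hτ : ∀ g, τ * ι g * τ⁻¹ = ι (α g) := by
      intro g
      have h := SemidirectProduct.inl_aut (φ := MonoidHom.id (MulAut G)) α g
      rw [map_inv] at h
      exact h.symm
    have hnormal : ((P : Subgroup G).map ι).Normal := by
      refine ⟨?_⟩
      rintro _ ⟨q, hq, rfl⟩ γ
      have h1 : γ = ι γ.left * SemidirectProduct.inr γ.right :=
        (SemidirectProduct.inl_left_mul_inr_right γ).symm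
      have h2 := SemidirectProduct.inl_aut (φ := MonoidHom.id (MulAut G)) γ.right q
      rw [map_inv] at h2
      have h3 : γ * ι q * γ⁻¹ = ι (γ.left * γ.right q * (γ.left)⁻¹) := by
        rw [map_mul, map_mul, map_inv]
        change _ = ι γ.left * SemidirectProduct.inl ((MonoidHom.id (MulAut G)) γ.right q) * _
        rw [h2]
        conv_lhs => rw [h1]
        rw [mul_inv_rev]
        simp only [mul_assoc]
        rfl
      rw [h3]
      refine Subgroup.mem_map_of_mem ι (hPnormal.conj_mem _ ?_ _)
      have h4 := hchar.fixed γ.right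
      rw [← h4] at hq
      exact hq
    have h := lemmaB hp hp2 r s (P : Subgroup G).index P.not_dvd_index (Nat.card Γ) Γ rfl
      ((P : Subgroup G).map ι) hnormal (P.isPGroup'.map ι) (ι a) (ι b)
      (Subgroup.mem_map_of_mem ι haP) (Subgroup.mem_map_of_mem ι hbP)
      (by
        rintro _ ⟨g, hg, rfl⟩
        obtain ⟨i, j, rfl⟩ := hgen g hg
        exact ⟨i, j, by simp⟩)
      (ι u) τ (by rw [hτ, hαa]) (by rw [hτ, hαb])
      (by rw [← map_mul, ← map_inv, ← map_mul, hua.eq, mul_inv_cancel_right])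
      (by rw [← map_mul, ← map_inv, ← map_mul, hrs]; simp)
      (by
        rw [hτ, ← map_inv, ← map_mul, ← map_pow]
        exact Subgroup.mem_map_of_mem ι (Subgroup.pow_index_mem _ _))
      (by
        rw [← map_mul, ← map_mul]
        exact fun h => hab (SemidirectProduct.inl_injective h))
    have h2 : (1 : ℤ) ≡ s [ZMOD p] := Int.modEq_iff_dvd.mpr h
    exact (Int.natCast_modEq_iff.mp (by exact_mod_cast h2)).symm
  -- `u` centralizes `P`
  have hub : Commute u b := by
    let φ : MulAut (P : Subgroup G) := MulAut.conjNormal u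
    have hφ : φ = 1 := by
      refine lemmaA P.isPGroup' ⟨a, haP⟩ ⟨b, hbP⟩ hgen' φ ?_ r s ?_ m ?_ ?_ hs
      · apply Subtype.ext
        change u * a * u⁻¹ = a
        rw [hua.eq, mul_inv_cancel_right]
      · apply Subtype.ext
        simpa [φ] using hrs
      · rw [← map_pow, hum, map_one]
      · exact ((Nat.Prime.coprime_iff_not_dvd hp).mpr hpm).symm
    have h1 : φ ⟨b, hbP⟩ = ⟨b, hbP⟩ := by rw [hφ]; rfl
    have h2 : u * b * u⁻¹ = b := congrArg Subtype.val h1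
    exact mul_inv_eq_iff_eq_mul.mp h2
  have hva : Commute v a := by
    have := hub.map α
    rwa [hαu, hαb] at this
  have hvb : Commute v b := by
    have := hua.map α
    rwa [hαu, hαa] at this
  have hcent : ∀ w, Commute w a → Commute w b →
      w ∈ Subgroup.centralizer ((P : Subgroup G) : Set G) := by
    intro w h1 h2
    rw [Subgroup.mem_centralizer_iff]
    intro g hg
    obtain ⟨i, j, rfl⟩ := hgen g hg
    exact ((h1.pow_right i).mul_right (h2.pow_right j)).symm.eq
  have hxs : x ∈ (P : Subgroup G) ⊔ Subgroup.centralizer ((P : Subgroup G) : Set G) :=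
    aux_pow_mem _ x hcop (by rw [← hadef]; exact Subgroup.mem_sup_left haP)
      (by rw [← hudef]; exact Subgroup.mem_sup_right (hcent u hua hub))
  have hys : y ∈ (P : Subgroup G) ⊔ Subgroup.centralizer ((P : Subgroup G) : Set G) :=
    aux_pow_mem _ y hcop (by rw [← hbdef]; exact Subgroup.mem_sup_left hbP)
      (by rw [← hvdef]; exact Subgroup.mem_sup_right (hcent v hva hvb))
  rw [eq_top_iff]
  intro g _
  have hg : g ∈ (↑(Subgroup.zpowers x) * ↑(Subgroup.zpowers y) : Set G) := by
    rw [hprod]; trivial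
  obtain ⟨_, ⟨i, rfl⟩, _, ⟨j, rfl⟩, rfl⟩ := hg
  exact Subgroup.mul_mem _ (Subgroup.zpow_mem _ hxs i) (Subgroup.zpow_mem _ hys j)
end

section
/- Let G be an n-isobicyclic group, let p and q be distinct primes dividing n, let P be a normal Sylow p-subgroup of G, and let Q be a Sylow q-subgroup of G. If P is nonabelian, then Q centralises P; that is, every element of Q commutes with every element of P. -/
open scoped Pointwise
open scoped commutatorElement

lemma aux_coatom {p : ℕ} [Fact p.Prime] {P : Type*} [Group P] [Finite P] (hP : IsPGroup p P)
    (N : Subgroup P) (hN : IsCoatom N) : N.Normal ∧ commutator P ≤ N ∧ ∀ g : P, g ^ p ∈ N := by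
  have hnil : Group.IsNilpotent P := hP.isNilpotent
  have hnorm : N.Normal := Subgroup.NormalizerCondition.normal_of_coatom N
    Group.normalizerCondition_of_isNilpotent hN
  have hnt : Nontrivial (P ⧸ N) := by
    rw [QuotientGroup.nontrivial_iff]; exact hN.1
  have hs : IsSimpleGroup (P ⧸ N) := by
    refine ⟨fun H hH => ?_⟩
    have hle : N ≤ H.comap (QuotientGroup.mk' N) := by
      intro g hg
      rw [Subgroup.mem_comap, QuotientGroup.mk'_apply, (QuotientGroup.eq_one_iff g).2 hg]
      exact H.one_mem
    rcases eq_or_lt_of_le hle with h | h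
    · left
      rw [← Subgroup.map_comap_eq_self_of_surjective (QuotientGroup.mk'_surjective N) H, ← h]
      simp
    · right
      have := hN.2 _ h
      rw [← Subgroup.map_comap_eq_self_of_surjective (QuotientGroup.mk'_surjective N) H, this]
      exact Subgroup.map_top_of_surjective _ (QuotientGroup.mk'_surjective N)
  have hq : IsPGroup p (P ⧸ N) := hP.to_quotient N
  have hnilq : Group.IsNilpotent (P ⧸ N) := hq.isNilpotent
  have hcomm : ∀ a b : P ⧸ N, a * b = b * a :=
    IsSimpleGroup.comm_iff_isSolvable.2 inferInstance
  refine ⟨hnorm, ?_, ?_⟩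
  · rw [commutator_def, Subgroup.commutator_le]
    intro g _ h _
    rw [← QuotientGroup.eq_one_iff]
    have := hcomm (g : P ⧸ N) h
    change (QuotientGroup.mk' N) ⁅g, h⁆ = 1
    rw [map_commutatorElement, commutatorElement_eq_one_iff_mul_comm]
    exact this
  · intro g
    have hpr : (Nat.card (P ⧸ N)).Prime := by
      have : IsMulCommutative (P ⧸ N) := ⟨⟨hcomm⟩⟩
      exact Group.is_simple_iff_prime_card.1 hs
    obtain ⟨k, hk⟩ := hq.exists_card_eq
    have : Nat.card (P ⧸ N) = p := by
      rw [hk] at hpr ⊢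
      have := (Nat.Prime.eq_one_of_pow hpr)
      rw [this, pow_one]
    rw [← QuotientGroup.eq_one_iff, QuotientGroup.mk_pow, ← this, pow_card_eq_one']

lemma aux_frattini {p : ℕ} [Fact p.Prime] {P : Type*} [Group P] [Finite P] (hP : IsPGroup p P) :
    commutator P ≤ frattini P ∧ ∀ g : P, g ^ p ∈ frattini P := by
  unfold frattini Order.radical
  refine ⟨?_, fun g => ?_⟩
  · simp only [le_iInf_iff]
    exact fun N hN => (aux_coatom hP N hN).2.1
  · simp only [Subgroup.mem_iInf]
    exact fun N hN => (aux_coatom hP N hN).2.2 g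

lemma aux_K {p : ℕ} [Fact p.Prime] {P : Type*} [Group P] [Finite P] (hP : IsPGroup p P)
    (hn : ¬ ∀ g h : P, g * h = h * g) :
    ∃ K : Subgroup P, K.Characteristic ∧ (∀ g ∈ commutator P, ∀ h : P, ⁅g, h⁆ ∈ K) ∧
      (∀ g ∈ commutator P, g ^ p ∈ K) ∧ ¬ commutator P ≤ K := by
  have hP' : IsPGroup p (commutator P) := hP.to_subgroup _
  refine ⟨⁅commutator P, ⊤⁆ ⊔ (frattini (commutator P)).map (commutator P).subtype,
    inferInstance, ?_, ?_, ?_⟩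
  · intro g hg h
    exact Subgroup.mem_sup_left (Subgroup.commutator_mem_commutator hg (Subgroup.mem_top h))
  · intro g hg
    apply Subgroup.mem_sup_right
    exact ⟨⟨g, hg⟩ ^ p, (aux_frattini hP').2 _, rfl⟩
  · intro hle
    have hle1 : ⁅commutator P, (⊤ : Subgroup P)⁆ ≤ commutator P := by
      rw [commutator_def]; exact Subgroup.commutator_mono le_top le_rfl
    have h1 : (⁅commutator P, (⊤ : Subgroup P)⁆.subgroupOf (commutator P)) ⊔
        frattini (commutator P) = ⊤ := by
      rw [eq_top_iff]
      rintro ⟨g, hg⟩ -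
      obtain ⟨s, hs, t, ht, rfl⟩ := Subgroup.mem_sup_of_normal_left.1 (hle hg)
      obtain ⟨t', ht', rfl⟩ := ht
      have : (⟨s * t', hg⟩ : commutator P) = ⟨s, hle1 hs⟩ * t' := rfl
      change (⟨s * t', hg⟩ : commutator P) ∈ _
      rw [this]
      exact Subgroup.mul_mem_sup (Subgroup.mem_subgroupOf.2 hs) ht'
    have h2 := frattini_nongenerating h1
    have h3 : commutator P ≤ ⁅commutator P, (⊤ : Subgroup P)⁆ := Subgroup.subgroupOf_eq_top.1 h2
    have hnil : Group.IsNilpotent P := hP.isNilpotent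
    obtain ⟨n, hn'⟩ := Subgroup.nilpotent_iff_lowerCentralSeries.1 hnil
    have h4 : ∀ n, commutator P ≤ (⊤ : Subgroup P).lowerCentralSeries n := by
      intro n
      induction n with
      | zero => exact le_top
      | succ k ih =>
        rw [Subgroup.lowerCentralSeries_succ]
        exact h3.trans (Subgroup.commutator_mono ih le_rfl)
    apply hn
    intro g h
    have : ⁅g, h⁆ ∈ commutator P := Subgroup.commutator_mem_commutator (Subgroup.mem_top g) (Subgroup.mem_top h)
    have := (hn' ▸ h4 n) this
    rw [Subgroup.mem_bot] at this
    exact commutatorElement_eq_one_iff_mul_comm.1 this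

lemma aux_pow_mul {R : Type*} [Group R] (r s c : R) (hc : s * r = r * s * c)
    (hr : Commute c r) (hs : Commute c s) (m : ℕ) :
    s ^ m * r = r * s ^ m * c ^ m ∧ (r * s) ^ m = r ^ m * s ^ m * c ^ (m.choose 2) := by
  have h1 : ∀ m : ℕ, s ^ m * r = r * s ^ m * c ^ m := by
    intro m
    induction m with
    | zero => simp
    | succ k ih =>
      rw [pow_succ, mul_assoc, hc, ← mul_assoc, ← mul_assoc, ih, pow_succ c,
        mul_assoc (r * s ^ k), ((hs.pow_left k)).eq]
      simp only [mul_assoc]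
  refine ⟨h1 m, ?_⟩
  induction m with
  | zero => simp
  | succ k ih =>
    have e : (k+1).choose 2 = k + k.choose 2 := by
      rw [Nat.choose_succ_succ' k 1]; simp
    rw [pow_succ, ih, e, pow_add c]
    have hh : Commute (c ^ k.choose 2) (r * s) := (hr.mul_right hs).pow_left _
    calc r ^ k * s ^ k * c ^ k.choose 2 * (r * s)
        = r ^ k * (s ^ k * r) * s * c ^ k.choose 2 := by
          rw [mul_assoc, hh.eq]; simp only [mul_assoc]
      _ = r ^ (k+1) * s ^ k * (c ^ k * s) * c ^ k.choose 2 := by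
          rw [h1, pow_succ r]; simp only [mul_assoc]
      _ = _ := by rw [(hs.pow_left k).eq, pow_succ s]; simp only [mul_assoc]

/-- power map is multiplicative -/
lemma aux_pow_hom {p : ℕ} (hp : p.Prime) (hp2 : p ≠ 2) {R : Type*} [Group R]
    (h1 : ∀ g ∈ commutator R, ∀ h : R, Commute g h) (h2 : ∀ g ∈ commutator R, g ^ p = 1)
    (k : ℕ) (r s : R) : (r * s) ^ (p ^ k) = r ^ (p ^ k) * s ^ (p ^ k) := by
  have hodd : p ∣ p.choose 2 := hp.dvd_choose_self (by norm_num) (by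
    have := hp.two_le; omega)
  have key : ∀ r s : R, (r * s) ^ p = r ^ p * s ^ p := by
    intro r s
    have hc : ⁅s⁻¹, r⁻¹⁆ ∈ commutator R :=
      Subgroup.commutator_mem_commutator (Subgroup.mem_top _) (Subgroup.mem_top _)
    have := (aux_pow_mul r s ⁅s⁻¹, r⁻¹⁆ (by simp [commutatorElement_def, mul_assoc])
      (h1 _ hc _) (h1 _ hc _) p).2
    obtain ⟨t, ht⟩ := hodd
    rw [this, ht, pow_mul, h2 _ hc]; simp
  induction k with
  | zero => simp
  | succ k ih => rw [pow_succ, pow_mul, pow_mul, pow_mul, ih, key]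

lemma aux_S {p : ℕ} [Fact p.Prime] {P : Type*} [Group P] [Finite P]
    (a b : P) (hab : ∀ g : P, ∃ i j : ℤ, g = a ^ i * b ^ j)
    (K : Subgroup P) [K.Characteristic] (m : ℕ)
    (hom : ∀ r s : P ⧸ K, (r * s) ^ m = r ^ m * s ^ m) (c : P ⧸ K) (hc : orderOf c = p)
    (ha : (a : P ⧸ K) ^ m ∈ Subgroup.zpowers c) (hb : (b : P ⧸ K) ^ m ∈ Subgroup.zpowers c)
    (hne : ¬ ((a : P ⧸ K) ^ m = 1 ∧ (b : P ⧸ K) ^ m = 1)) :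
    ∃ M : Subgroup P, M.Characteristic ∧ M.index = p := by
  let f : P →* P ⧸ K := MonoidHom.mk' (fun r => (r : P ⧸ K) ^ m) (by
    intro r s
    rw [QuotientGroup.mk_mul, hom])
  have hf : ∀ g, f g = (g : P ⧸ K) ^ m := fun g => rfl
  refine ⟨f.ker, ?_, ?_⟩
  · rw [Subgroup.characteristic_iff_le_comap]
    intro φ g hg
    rw [MonoidHom.mem_ker, hf, ← QuotientGroup.mk_pow, QuotientGroup.eq_one_iff] at hg
    rw [Subgroup.mem_comap, MonoidHom.mem_ker, hf, ← QuotientGroup.mk_pow,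
      QuotientGroup.eq_one_iff, ← map_pow]
    exact Subgroup.characteristic_iff_le_comap.1 inferInstance φ hg
  · rw [Subgroup.index_ker]
    have hle : f.range ≤ Subgroup.zpowers c := by
      rintro _ ⟨g, rfl⟩
      obtain ⟨i, j, rfl⟩ := hab g
      rw [map_mul, map_zpow, map_zpow]
      exact mul_mem (zpow_mem ha i) (zpow_mem hb j)
    have hd := Subgroup.card_dvd_of_le hle
    rw [Nat.card_zpowers, hc] at hd
    rcases (Nat.dvd_prime Fact.out).1 hd with h | h
    · exfalso
      apply hne
      have h1 := Subgroup.card_eq_one.1 h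
      rw [MonoidHom.range_eq_bot_iff] at h1
      exact ⟨by rw [← hf, h1]; rfl, by rw [← hf, h1]; rfl⟩
    · exact h

lemma aux_prime_pow_zpow {p : ℕ} (hp : p.Prime) {A : Type*} [Group A] (g : A) (k : ℕ)
    (hg : orderOf g = p ^ (k + 1)) (i : ℤ) (hi : g ^ i ≠ 1) :
    g ^ (p ^ k) ∈ Subgroup.zpowers (g ^ i) := by
  have hd : Int.gcd i (p ^ (k+1) : ℕ) ∣ p ^ (k+1) := by
    exact_mod_cast Int.gcd_dvd_right i (p ^ (k+1) : ℕ)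
  obtain ⟨l, hl, hl'⟩ := (Nat.dvd_prime_pow hp).1 hd
  have hlk : l ≤ k := by
    by_contra h
    have : l = k + 1 := by omega
    apply hi
    rw [← orderOf_dvd_iff_zpow_eq_one, hg, ← this, ← hl']
    exact Int.gcd_dvd_left i _
  have hbez := Int.gcd_eq_gcd_ab i (p ^ (k+1) : ℕ)
  have h1 : g ^ (p ^ l) ∈ Subgroup.zpowers (g ^ i) := by
    rw [← zpow_natCast, ← hl', hbez, zpow_add, zpow_mul, zpow_mul g, zpow_natCast g, ← hg,
      pow_orderOf_eq_one]
    simp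
  have : p ^ k = p ^ l * p ^ (k - l) := by rw [← pow_add]; congr 1; omega
  rw [this, pow_mul]
  exact pow_mem h1 _

lemma aux_exists_char {p : ℕ} [Fact p.Prime] (hp2 : p ≠ 2) {P : Type*} [Group P] [Finite P]
    (hP : IsPGroup p P)
    (a b : P) (hab : ∀ g : P, ∃ i j : ℤ, g = a ^ i * b ^ j)
    (β : P ≃* P) (hβa : β a = b) (hβb : β b = a)
    (hn : ¬ ∀ g h : P, g * h = h * g) :
    ∃ M : Subgroup P, M.Characteristic ∧ M.index = p := by
  have hp : p.Prime := Fact.out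
  have hcommA : ∀ g h : P ⧸ commutator P, g * h = h * g := by
    intro g h
    exact mul_comm (G := Abelianization P) g h
  have hswap1 : ∀ m : ℕ, a ^ m ∈ commutator P → b ^ m ∈ commutator P := by
    intro m hm
    have := Subgroup.characteristic_iff_le_comap.1 (inferInstance : (commutator P).Characteristic) β hm
    simpa [hβa] using this
  have hswap2 : ∀ m : ℕ, b ^ m ∈ commutator P → a ^ m ∈ commutator P := by
    intro m hm
    have := Subgroup.characteristic_iff_le_comap.1 (inferInstance : (commutator P).Characteristic) β hm
    simpa [hβb] using this
  obtain ⟨k', hk'⟩ := IsPGroup.iff_orderOf.1 (hP.to_quotient (commutator P)) (a : P ⧸ commutator P)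
  have hkb' : orderOf (b : P ⧸ commutator P) = p ^ k' := by
    rw [← hk', orderOf_eq_orderOf_iff]
    intro m
    rw [← QuotientGroup.mk_pow, ← QuotientGroup.mk_pow, QuotientGroup.eq_one_iff,
      QuotientGroup.eq_one_iff]
    exact ⟨hswap2 m, hswap1 m⟩
  obtain ⟨k, rfl⟩ : ∃ k, k' = k + 1 := by
    rcases k' with _ | k
    · exfalso
      rw [pow_zero, orderOf_eq_one_iff, QuotientGroup.eq_one_iff] at hk' hkb'
      have htop : commutator P = ⊤ := by
        rw [eq_top_iff]
        intro g _
        obtain ⟨i, j, rfl⟩ := hab g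
        exact mul_mem (zpow_mem hk' i) (zpow_mem hkb' j)
      have h1 := (aux_frattini hP).1
      rw [htop, top_le_iff] at h1
      have h2 : (⊥ : Subgroup P) = ⊤ := frattini_nongenerating (by rw [h1]; simp)
      apply hn
      intro g h
      have hg : g ∈ (⊥ : Subgroup P) := h2 ▸ Subgroup.mem_top g
      rw [Subgroup.mem_bot] at hg
      simp [hg]
    · exact ⟨k, rfl⟩
  by_cases hB : ∀ i j : ℤ, (a : P ⧸ commutator P) ^ i * (b : P ⧸ commutator P) ^ j = 1 →
      (a : P ⧸ commutator P) ^ i = 1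
  · obtain ⟨K, hKchar, hK1, hK2, hK3⟩ := aux_K hP hn
    have hR' : commutator (P ⧸ K) ≤ (commutator P).map (QuotientGroup.mk' K) := by
      rw [commutator_def, Subgroup.commutator_le]
      intro r _ s _
      obtain ⟨r, rfl⟩ := QuotientGroup.mk'_surjective K r
      obtain ⟨s, rfl⟩ := QuotientGroup.mk'_surjective K s
      exact ⟨⁅r, s⁆, Subgroup.commutator_mem_commutator (Subgroup.mem_top _) (Subgroup.mem_top _),
        map_commutatorElement _ _ _⟩
    have hcen : ∀ g ∈ commutator P, ∀ h : P ⧸ K, Commute (QuotientGroup.mk' K g) h := by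
      intro g hg h
      obtain ⟨h, rfl⟩ := QuotientGroup.mk'_surjective K h
      have := hK1 g hg h
      rw [← QuotientGroup.eq_one_iff] at this
      rw [← QuotientGroup.mk'_apply, map_commutatorElement,
        commutatorElement_eq_one_iff_mul_comm] at this
      exact this
    have hexp : ∀ g ∈ commutator P, (QuotientGroup.mk' K g) ^ p = 1 := by
      intro g hg
      rw [← map_pow]
      exact (QuotientGroup.eq_one_iff _).2 (hK2 g hg)
    have hz : ⁅a, b⁆ ∈ commutator P :=
      Subgroup.commutator_mem_commutator (Subgroup.mem_top _) (Subgroup.mem_top _)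
    set c := QuotientGroup.mk' K ⁅a, b⁆ with hcdef
    have hNn : (Subgroup.zpowers c).Normal := by
      constructor
      rintro _ ⟨i, rfl⟩ r
      have := ((hcen _ hz r).zpow_left i).eq
      refine ⟨i, ?_⟩
      change c ^ i = r * c ^ i * r⁻¹
      exact (mul_inv_eq_of_eq_mul this.symm).symm
    have hN : ∀ r ∈ commutator (P ⧸ K), r ∈ Subgroup.zpowers c := by
      have : commutator (P ⧸ K) ≤ Subgroup.zpowers c := by
        rw [commutator_def, Subgroup.commutator_le]
        intro r _ s _
        rw [← QuotientGroup.eq_one_iff]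
        let π : P →* (P ⧸ K) ⧸ (Subgroup.zpowers c) :=
          (QuotientGroup.mk' (Subgroup.zpowers c)).comp (QuotientGroup.mk' K)
        have hπ : Commute (π a) (π b) := by
          change π a * π b = π b * π a
          rw [← commutatorElement_eq_one_iff_mul_comm, ← map_commutatorElement]
          exact (QuotientGroup.eq_one_iff c).2 (Subgroup.mem_zpowers c)
        obtain ⟨r, rfl⟩ := QuotientGroup.mk'_surjective K r
        obtain ⟨s, rfl⟩ := QuotientGroup.mk'_surjective K s
        have : Commute (π r) (π s) := by
          obtain ⟨i, j, rfl⟩ := hab r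
          obtain ⟨i', j', rfl⟩ := hab s
          simp only [map_mul, map_zpow]
          have e1 : Commute (π a) (π a ^ i' * π b ^ j') :=
            ((Commute.refl _).zpow_right _).mul_right (hπ.zpow_right _)
          have e2 : Commute (π b) (π a ^ i' * π b ^ j') :=
            (hπ.symm.zpow_right _).mul_right ((Commute.refl _).zpow_right _)
          exact (e1.zpow_left _).mul_left (e2.zpow_left _)
        have h3 := commutatorElement_eq_one_iff_mul_comm.2 this.eq
        rw [← map_commutatorElement] at h3
        rw [← map_commutatorElement]
        exact h3
      exact this
    have hN' : ∀ g ∈ commutator P, QuotientGroup.mk' K g ∈ Subgroup.zpowers c := by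
      have : commutator P ≤ (Subgroup.zpowers c).comap (QuotientGroup.mk' K) := by
        rw [commutator_def, Subgroup.commutator_le]
        intro r _ s _
        rw [Subgroup.mem_comap, map_commutatorElement]
        exact hN _ (Subgroup.commutator_mem_commutator (Subgroup.mem_top _) (Subgroup.mem_top _))
      exact this
    have hc1 : c ≠ 1 := by
      intro h
      apply hK3
      intro g hg
      have := hN' g hg
      rw [h, Subgroup.zpowers_one_eq_bot, Subgroup.mem_bot] at this
      exact (QuotientGroup.eq_one_iff g).1 this
    have hpa : a ^ (p ^ (k+1)) ∈ commutator P := by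
      rw [← QuotientGroup.eq_one_iff, QuotientGroup.mk_pow, ← hk', pow_orderOf_eq_one]
    have hpb : b ^ (p ^ (k+1)) ∈ commutator P := hswap1 _ hpa
    refine aux_S a b hab K (p ^ (k+1)) (fun r s => aux_pow_hom hp hp2 ?_ ?_ _ r s) c
      (orderOf_eq_prime (hexp _ hz) hc1) (hN' _ hpa) (hN' _ hpb) ?_
    · intro g hg h
      obtain ⟨g, hg', rfl⟩ := hR' hg
      exact hcen g hg' h
    · intro g hg
      obtain ⟨g, hg', rfl⟩ := hR' hg
      exact hexp g hg'
    · rintro ⟨ha1, hb1⟩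
      apply hc1
      obtain ⟨i, j, hij⟩ := hab ⁅a, b⁆
      have h1 : (a : P ⧸ commutator P) ^ i * (b : P ⧸ commutator P) ^ j = 1 := by
        rw [← QuotientGroup.mk_zpow, ← QuotientGroup.mk_zpow, ← QuotientGroup.mk_mul, ← hij,
          QuotientGroup.eq_one_iff]
        exact hz
      have h2 := hB i j h1
      have h3 := h1
      rw [h2, one_mul] at h3
      rw [← orderOf_dvd_iff_zpow_eq_one, hk'] at h2
      rw [← orderOf_dvd_iff_zpow_eq_one, hkb'] at h3
      obtain ⟨i', rfl⟩ := h2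
      obtain ⟨j', rfl⟩ := h3
      rw [hcdef, hij, map_mul, map_zpow, map_zpow, zpow_mul, zpow_mul, zpow_natCast, zpow_natCast]
      change (a : P ⧸ K) ^ (p ^ (k+1)) = 1 at ha1
      rw [QuotientGroup.mk'_apply, QuotientGroup.mk'_apply, ha1, hb1]
      simp
  · push Not at hB
    obtain ⟨i, j, hij, hi⟩ := hB
    have hoa : orderOf ((a : P ⧸ commutator P) ^ (p ^ k)) = p := by
      rw [orderOf_pow, hk', pow_succ, Nat.gcd_eq_right (Dvd.intro _ rfl)]
      exact Nat.mul_div_cancel_left p (pow_pos hp.pos k)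
    have hji : (b : P ⧸ commutator P) ^ j = ((a : P ⧸ commutator P) ^ i)⁻¹ :=
      eq_inv_of_mul_eq_one_right hij
    refine aux_S a b hab (commutator P) (p ^ k) (fun r s => ?_) ((a : P ⧸ commutator P) ^ (p ^ k))
      hoa (Subgroup.mem_zpowers _) ?_ ?_
    · exact (Commute.mul_pow (hcommA r s) _)
    · have h1 := aux_prime_pow_zpow hp _ k hkb' j (by rw [hji]; simpa using hi)
      rw [hji, Subgroup.zpowers_inv] at h1
      obtain ⟨t, ht⟩ := h1
      have ht' : (a : P ⧸ commutator P) ^ (i * t) = (b : P ⧸ commutator P) ^ (p ^ k) := by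
        rw [← ht, zpow_mul]
      have h2 : (a : P ⧸ commutator P) ^ (i * t * p) = 1 := by
        rw [zpow_mul, ht', zpow_natCast, ← pow_mul, ← pow_succ, ← hkb', pow_orderOf_eq_one]
      rw [← orderOf_dvd_iff_zpow_eq_one, hk', pow_succ, Nat.cast_mul] at h2
      have h3 := Int.dvd_of_mul_dvd_mul_right (by exact_mod_cast hp.ne_zero) h2
      obtain ⟨s, hs⟩ := h3
      rw [← ht', hs, zpow_mul, zpow_natCast]
      exact ⟨s, rfl⟩
    · rintro ⟨h, -⟩
      rw [h, orderOf_one] at hoa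
      exact hp.one_lt.ne hoa

/-- automorphisms acting trivially modulo `F` -/
def auxT {P : Type*} [Group P] (F : Subgroup P) : Subgroup (MulAut P) where
  carrier := {w | ∀ g, g⁻¹ * w g ∈ F}
  one_mem' := by intro g; simp [F.one_mem]
  mul_mem' := by
    intro w v hw hv g
    have := F.mul_mem (hv g) (hw (v g))
    simpa [mul_assoc] using this
  inv_mem' := by
    intro w hw g
    have := F.inv_mem (hw (w⁻¹ g))
    simpa using this

lemma aux_mem_T {P : Type*} [Group P] (F : Subgroup P) (w : MulAut P) :
    w ∈ auxT F ↔ ∀ g, g⁻¹ * w g ∈ F := Iff.rfl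

lemma aux_char_mem {P : Type*} [Group P] {F : Subgroup P} [F.Characteristic] (w : P ≃* P)
    {g : P} (hg : g ∈ F) : w g ∈ F :=
  Subgroup.characteristic_iff_le_comap.1 inferInstance w hg

lemma aux_T_of_gen {P : Type*} [Group P] (F : Subgroup P) [F.Normal] (a b : P)
    (hab : ∀ g : P, ∃ i j : ℤ, g = a ^ i * b ^ j) (w : MulAut P)
    (ha : a⁻¹ * w a ∈ F) (hb : b⁻¹ * w b ∈ F) : w ∈ auxT F := by
  intro g
  rw [← QuotientGroup.eq] at ha hb ⊢
  obtain ⟨i, j, rfl⟩ := hab g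
  rw [map_mul, map_zpow, map_zpow]
  simp only [QuotientGroup.mk_mul, QuotientGroup.mk_zpow]
  rw [ha, hb]

lemma aux_coprime_mem {H : Type*} [Group H] (T : Subgroup H) (w : H) (m n : ℕ)
    (hmn : Nat.Coprime m n) (hm : w ^ m ∈ T) (hn : w ^ n ∈ T) : w ∈ T := by
  have hbez := Nat.gcd_eq_gcd_ab m n
  rw [hmn] at hbez
  have : w = (w ^ m) ^ (m.gcdA n) * (w ^ n) ^ (m.gcdB n) := by
    rw [← zpow_natCast, ← zpow_natCast, ← zpow_mul, ← zpow_mul, ← zpow_add, ← hbez]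
    simp
  rw [this]
  exact mul_mem (zpow_mem hm _) (zpow_mem hn _)

lemma aux_fixed {p q r : ℕ} [Fact p.Prime] [Fact q.Prime] (hpq : p ≠ q)
    {P : Type*} [Group P] [Finite P] (hP : IsPGroup p P) (a b : P)
    (hab : ∀ g : P, ∃ i j : ℤ, g = a ^ i * b ^ j) (u : MulAut P) (hu : u a = a)
    (hur : u ^ (q ^ r) = 1) (hT : u ∈ auxT (frattini P)) : u = 1 := by
  set F := frattini P with hF
  have hz : Subgroup.zpowers u ≤ auxT F := by rwa [Subgroup.zpowers_le]
  have hQ : IsPGroup q (Subgroup.zpowers u) := by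
    rintro ⟨w, i, rfl⟩
    refine ⟨r, ?_⟩
    ext1
    change (u ^ i) ^ (q ^ r) = 1
    rw [← zpow_natCast, zpow_comm, zpow_natCast, hur, one_zpow]
  let S : SubMulAction (Subgroup.zpowers u) P :=
    { carrier := {g | b⁻¹ * g ∈ F}
      smul_mem' := by
        rintro ⟨w, hw⟩ g hg
        have := F.mul_mem hg (hz hw g)
        change b⁻¹ * w g ∈ F
        simpa [mul_assoc] using this }
  have hcard : Nat.card S = Nat.card F := by
    refine Nat.card_congr ⟨fun g => ⟨b⁻¹ * g.1, g.2⟩, fun f => ⟨b * f.1, ?_⟩, ?_, ?_⟩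
    · change b⁻¹ * (b * f.1) ∈ F
      simp
    · intro g; simp
    · intro g; simp
  have hfix := hQ.card_modEq_card_fixedPoints S
  obtain ⟨s, hs⟩ := (hP.to_subgroup F).exists_card_eq
  have hne : (MulAction.fixedPoints (Subgroup.zpowers u) S).Nonempty := by
    by_contra h
    rw [Set.not_nonempty_iff_eq_empty] at h
    rw [h, hcard, hs] at hfix
    simp only [Nat.card_eq_fintype_card, Fintype.card_eq_zero] at hfix
    have h1 := (Nat.modEq_zero_iff_dvd.1 hfix)
    have h2 := (Fact.out : q.Prime).dvd_of_dvd_pow h1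
    exact hpq ((Nat.prime_dvd_prime_iff_eq Fact.out Fact.out).1 h2).symm
  obtain ⟨⟨b', hb'⟩, hfx⟩ := hne
  have hub : u b' = b' := by
    have := hfx ⟨u, Subgroup.mem_zpowers u⟩
    exact congrArg Subtype.val this
  have hb'F : b⁻¹ * b' ∈ F := hb'
  let H : Subgroup P := (u : P ≃* P).toMonoidHom.eqLocus (MonoidHom.id P)
  have hHF : H ⊔ frattini P = ⊤ := by
    rw [eq_top_iff]
    intro g _
    have ha : a ∈ H ⊔ frattini P := Subgroup.mem_sup_left hu
    have hb : b ∈ H ⊔ frattini P := by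
      have : b = b' * (b⁻¹ * b')⁻¹ := by simp
      rw [this]
      exact Subgroup.mul_mem_sup hub (F.inv_mem hb'F)
    obtain ⟨i, j, rfl⟩ := hab g
    exact mul_mem (zpow_mem ha i) (zpow_mem hb j)
  have hH := frattini_nongenerating hHF
  ext g
  have : g ∈ H := hH ▸ Subgroup.mem_top g
  exact this

lemma aux_unip {p : ℕ} {P : Type*} [Group P] (F M : Subgroup P) [F.Characteristic]
    (hpow : ∀ g : P, g ^ p ∈ F) (w : MulAut P) (h1 : w ∈ auxT M)
    (h2 : ∀ m ∈ M, m⁻¹ * w m ∈ F) : w ^ p ∈ auxT F := by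
  intro g
  set m := g⁻¹ * w g with hm
  have key : ∀ n : ℕ, (((w ^ n) g : P) : P ⧸ F) = (g * m ^ n : P) := by
    intro n
    induction n with
    | zero => simp
    | succ k ih =>
      have e1 : (((w ^ (k+1)) g : P) : P ⧸ F) = (w (g * m ^ k) : P) := by
        rw [pow_succ', MulAut.mul_apply, QuotientGroup.eq, ← map_inv, ← map_mul]
        apply aux_char_mem
        rw [← QuotientGroup.eq]
        exact ih
      have e2 : (m : P ⧸ F) = (w m : P) := QuotientGroup.eq.2 (h2 m (h1 g))
      have e3 : w g = g * m := by rw [hm]; simp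
      rw [e1, map_mul, map_pow, e3, QuotientGroup.mk_mul, QuotientGroup.mk_pow, ← e2, pow_succ']
      simp [mul_assoc]
  rw [← QuotientGroup.eq, key, QuotientGroup.mk_mul, (QuotientGroup.eq_one_iff _).2 (hpow m)]
  simp

lemma aux_T_index {p : ℕ} [Fact p.Prime] {P : Type*} [Group P] [Finite P]
    (M : Subgroup P) [M.Characteristic] (hM : M.index = p) (a : P) (ha : a ∉ M)
    (u : MulAut P) (hu : u a = a) : u ∈ auxT M := by
  intro g
  have h1 : (g : P ⧸ M) ∈ Subgroup.zpowers (a : P ⧸ M) :=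
    mem_zpowers_of_prime_card (p := p) hM (by rwa [ne_eq, QuotientGroup.eq_one_iff])
  obtain ⟨i, hi⟩ := h1
  have hi' : ((a ^ i : P) : P ⧸ M) = g := by rw [← hi]; rfl
  have h2 := QuotientGroup.eq.1 hi'
  have h3 := aux_char_mem (F := M) u h2
  have : g⁻¹ * u g = ((a ^ i)⁻¹ * g)⁻¹ * u ((a ^ i)⁻¹ * g) := by
    simp [hu, mul_assoc]
  rw [this]
  exact mul_mem (inv_mem h2) h3

lemma aux_cyc {p : ℕ} [Fact p.Prime] {P : Type*} [Group P] [Finite P] (hP : IsPGroup p P)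
    (a b : P) (hab : ∀ g : P, ∃ i j : ℤ, g = a ^ i * b ^ j)
    (M : Subgroup P) [M.Characteristic] (hM : M.index = p) :
    ∃ c ∈ M, ∀ m ∈ M, ∃ i : ℤ, (m : P ⧸ frattini P) = (c : P ⧸ frattini P) ^ i := by
  have hp : p.Prime := Fact.out
  set F := frattini P with hF
  have hFM : F ≤ M := by
    apply frattini_le_coatom
    refine ⟨?_, ?_⟩
    · rintro rfl
      rw [Subgroup.index_top] at hM
      exact hp.one_lt.ne hM
    · intro N hN
      have h1 := Subgroup.index_dvd_of_le hN.le
      rw [hM] at h1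
      rcases (Nat.dvd_prime hp).1 h1 with h | h
      · exact Subgroup.index_eq_one.1 h
      · exfalso
        have h2 := Subgroup.relIndex_mul_index hN.le
        rw [hM, h] at h2
        have h3 : M.relIndex N = 1 := Nat.eq_of_mul_eq_mul_right hp.pos (by rw [h2, one_mul])
        exact hN.not_ge (Subgroup.relIndex_eq_one.1 h3)
  have hord : ∀ g : P, orderOf (g : P ⧸ F) ≤ p := by
    intro g
    apply Nat.le_of_dvd hp.pos
    rw [orderOf_dvd_iff_pow_eq_one, ← QuotientGroup.mk_pow, QuotientGroup.eq_one_iff]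
    exact (aux_frattini hP).2 g
  have hcard : Nat.card (P ⧸ F) ≤ p * p := by
    let f : Subgroup.zpowers (a : P ⧸ F) × Subgroup.zpowers (b : P ⧸ F) → P ⧸ F :=
      fun t => t.1.1 * t.2.1
    have hf : Function.Surjective f := by
      intro g
      obtain ⟨g, rfl⟩ := QuotientGroup.mk_surjective g
      obtain ⟨i, j, rfl⟩ := hab g
      exact ⟨⟨⟨_, i, rfl⟩, ⟨_, j, rfl⟩⟩, rfl⟩
    have := Nat.card_le_card_of_surjective f hf
    rw [Nat.card_prod, Nat.card_zpowers, Nat.card_zpowers] at this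
    exact this.trans (Nat.mul_le_mul (hord a) (hord b))
  set Mb := M.map (QuotientGroup.mk' F) with hMb
  have hidx : Mb.index = p := by
    rw [hMb, Subgroup.index_map_eq M (QuotientGroup.mk'_surjective F)
      (by rw [QuotientGroup.ker_mk']; exact hFM), hM]
  have hMbc : Nat.card Mb ≤ p := by
    have := Subgroup.card_mul_index Mb
    rw [hidx] at this
    rw [← this] at hcard
    exact Nat.le_of_mul_le_mul_right hcard hp.pos
  have hcyc : IsCyclic Mb := by
    obtain ⟨s, hs⟩ := ((hP.to_quotient F).to_subgroup Mb).exists_card_eq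
    rcases s with _ | s
    · have : Subsingleton Mb := (Nat.card_eq_one_iff_unique.1 (by simpa using hs)).1
      infer_instance
    · have : Nat.card Mb = p := by
        refine le_antisymm hMbc ?_
        rw [hs]
        exact Nat.le_self_pow (by omega) p
      exact isCyclic_of_prime_card this
  obtain ⟨⟨_, c, hc, rfl⟩, hgen⟩ := hcyc.exists_generator
  refine ⟨c, hc, fun m hm => ?_⟩
  obtain ⟨i, hi⟩ := hgen ⟨QuotientGroup.mk' F m, m, hm, rfl⟩
  refine ⟨i, ?_⟩
  exact (congrArg Subtype.val hi).symm

lemma aux_main {p q r : ℕ} [Fact p.Prime] [Fact q.Prime] (hpq : p ≠ q)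
    {P : Type*} [Group P] [Finite P] (hP : IsPGroup p P) (a b : P)
    (hab : ∀ g : P, ∃ i j : ℤ, g = a ^ i * b ^ j)
    (hn : ¬ ∀ g h : P, g * h = h * g)
    (β : P ≃* P) (hβa : β a = b) (hβb : β b = a) (u v : MulAut P) (hu : u a = a)
    (hur : u ^ (q ^ r) = 1) (hv : ∀ g, v (β g) = β (u g)) (N : ℕ) (hN : Nat.Coprime p N)
    (hw : (u * v⁻¹) ^ N ∈ auxT (commutator P)) : u = 1 := by
  obtain ⟨hF1, hF2⟩ := aux_frattini hP
  apply aux_fixed hpq hP a b hab u hu hur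
  by_cases hp2 : p = 2
  · subst hp2
    refine aux_coprime_mem _ u 2 (q ^ r) ?_ ?_ (by rw [hur]; exact one_mem _)
    · apply Nat.Coprime.pow_right
      exact (Nat.coprime_primes Fact.out Fact.out).2 hpq
    · refine aux_T_of_gen _ a b hab _ ?_ ?_
      · simp [pow_two, hu]
      · rw [← QuotientGroup.eq, pow_two, MulAut.mul_apply]
        have hcong : ∀ (w : MulAut P) (g h : P), (g : P ⧸ frattini P) = h →
            ((w g : P) : P ⧸ frattini P) = (w h : P) := by
          intro w g h hgh
          rw [QuotientGroup.eq] at hgh ⊢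
          rw [← map_inv, ← map_mul]
          exact aux_char_mem w hgh
        have hsq : ∀ g : P, (g : P ⧸ frattini P) ^ 2 = 1 := fun g =>
          (QuotientGroup.eq_one_iff _).2 (hF2 g)
        obtain ⟨i, j, hij⟩ := hab (u b)
        rcases Int.even_or_odd' j with ⟨t, ht | ht⟩
        · have h1 : ((u b : P) : P ⧸ frattini P) = (a ^ i : P) := by
            rw [hij, ht, QuotientGroup.mk_mul, QuotientGroup.mk_zpow _ b, zpow_mul]
            rw [show (2 : ℤ) = ((2 : ℕ) : ℤ) from rfl, zpow_natCast, hsq]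
            simp
          have h2 := hcong u⁻¹ _ _ h1
          have hu' : u⁻¹ a = a := by
            conv_lhs => rw [← hu]
            simp
          rw [map_zpow, hu', MulAut.inv_apply_self] at h2
          have h3 := hcong u _ _ h1
          rw [map_zpow, hu] at h3
          rw [h3, h2]
        · have h1 : ((u b : P) : P ⧸ frattini P) = (a ^ i * b : P) := by
            rw [hij, ht, QuotientGroup.mk_mul, QuotientGroup.mk_zpow _ b, zpow_add, zpow_mul]
            rw [show (2 : ℤ) = ((2 : ℕ) : ℤ) from rfl, zpow_natCast, hsq]
            simp
          have h3 := hcong u _ _ h1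
          rw [h3, map_mul, map_zpow, hu, QuotientGroup.mk_mul, h1, QuotientGroup.mk_mul,
            ← mul_assoc, ← pow_two, hsq, one_mul]
  · obtain ⟨M, hMc, hM⟩ := aux_exists_char hp2 hP a b hab β hβa hβb hn
    have hpp : p.Prime := Fact.out
    have hiff : a ∈ M ↔ b ∈ M := by
      constructor
      · intro h; rw [← hβa]; exact aux_char_mem β h
      · intro h; rw [← hβb]; exact aux_char_mem β h
    have haM : a ∉ M := by
      intro h
      have : M = ⊤ := by
        rw [eq_top_iff]
        intro g _
        obtain ⟨i, j, rfl⟩ := hab g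
        exact mul_mem (zpow_mem h i) (zpow_mem (hiff.1 h) j)
      rw [this, Subgroup.index_top] at hM
      exact hpp.one_lt.ne hM
    have hvb : v b = b := by rw [← hβa, hv, hu]
    have huT := aux_T_index M hM a haM u hu
    have hvT := aux_T_index M hM b (fun h => haM (hiff.2 h)) v hvb
    obtain ⟨c, hcM, hc⟩ := aux_cyc hP a b hab M hM
    obtain ⟨d, hd⟩ := hc (u c) (aux_char_mem u hcM)
    have hcong : ∀ (w : P ≃* P) (g h : P), (g : P ⧸ frattini P) = h →
        ((w g : P) : P ⧸ frattini P) = (w h : P) := by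
      intro w g h hgh
      rw [QuotientGroup.eq] at hgh ⊢
      rw [← map_inv, ← map_mul]
      exact aux_char_mem w hgh
    have hud : ∀ m ∈ M, ((u m : P) : P ⧸ frattini P) = (m ^ d : P) := by
      intro m hm
      obtain ⟨i, hi⟩ := hc m hm
      rw [← QuotientGroup.mk_zpow] at hi
      rw [hcong u _ _ hi, map_zpow, QuotientGroup.mk_zpow, hd, QuotientGroup.mk_zpow, hi,
        QuotientGroup.mk_zpow, zpow_comm]
    have hvd : ∀ m ∈ M, ((v m : P) : P ⧸ frattini P) = (m ^ d : P) := by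
      intro m hm
      have h1 := hud (β.symm m) (aux_char_mem β.symm hm)
      have h2 := hcong β _ _ h1
      rw [← hv] at h2
      simpa using h2
    have hwF : u * v⁻¹ ∈ auxT (frattini P) := by
      refine aux_coprime_mem _ _ p N hN ?_ (fun g => hF1 (hw g))
      refine aux_unip (frattini P) M hF2 _ (mul_mem huT (inv_mem hvT)) ?_
      intro m hm
      have hm' : v⁻¹ m ∈ M := aux_char_mem _ hm
      rw [← QuotientGroup.eq, MulAut.mul_apply, hud _ hm', ← hvd _ hm']
      simp
    refine aux_T_of_gen _ a b hab u (by simp [hu]) ?_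
    have := hwF b
    have hvb' : v⁻¹ b = b := by
      conv_lhs => rw [← hvb]
      simp
    rwa [MulAut.mul_apply, hvb'] at this

lemma aux_index {G : Type*} [Group G] [Finite G] (x y : G)
    (hprod : (↑(Subgroup.zpowers x) * ↑(Subgroup.zpowers y) : Set G) = Set.univ)
    (C : Subgroup G) [C.Normal] (m : ℕ) (hx : x ^ m ∈ C) (hy : y ^ m ∈ C) :
    C.index ∣ m * m := by
  set xb : G ⧸ C := QuotientGroup.mk x with hxb
  set yb : G ⧸ C := QuotientGroup.mk y with hyb
  have hox : orderOf xb ∣ m := by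
    rw [orderOf_dvd_iff_pow_eq_one]; exact (QuotientGroup.eq_one_iff _).2 hx
  have hoy : orderOf yb ∣ m := by
    rw [orderOf_dvd_iff_pow_eq_one]; exact (QuotientGroup.eq_one_iff _).2 hy
  have htr : MulAction.IsPretransitive (Subgroup.zpowers xb) ((G ⧸ C) ⧸ Subgroup.zpowers yb) := by
    rw [MulAction.isPretransitive_iff_base (((1 : G ⧸ C)) : (G ⧸ C) ⧸ Subgroup.zpowers yb)]
    intro t
    obtain ⟨t, rfl⟩ := QuotientGroup.mk_surjective t
    obtain ⟨g, rfl⟩ := QuotientGroup.mk_surjective t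
    have hg : g ∈ (↑(Subgroup.zpowers x) * ↑(Subgroup.zpowers y) : Set G) := by
      rw [hprod]; trivial
    obtain ⟨_, ⟨i, rfl⟩, _, ⟨j, rfl⟩, rfl⟩ := hg
    refine ⟨⟨xb ^ i, i, rfl⟩, ?_⟩
    change ((xb ^ i * 1 : G ⧸ C) : (G ⧸ C) ⧸ Subgroup.zpowers yb) = _
    rw [QuotientGroup.eq]
    refine ⟨j, ?_⟩
    simp [hxb, hyb]
  have h1 : (Subgroup.zpowers yb).index ∣ m := by
    have h2 := MulAction.index_stabilizer_of_transitive (Subgroup.zpowers xb)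
      (((1 : G ⧸ C)) : (G ⧸ C) ⧸ Subgroup.zpowers yb)
    change Nat.card ((G ⧸ C) ⧸ Subgroup.zpowers yb) ∣ m
    rw [← h2]
    refine (Subgroup.index_dvd_card _).trans ?_
    rw [Nat.card_zpowers]
    exact hox
  change Nat.card (G ⧸ C) ∣ m * m
  rw [← Subgroup.card_mul_index (Subgroup.zpowers yb), Nat.card_zpowers]
  exact Nat.mul_dvd_mul hoy h1

theorem sylow_acts_trivially_on_nonabelian_normal_sylow
    {G : Type*} [Group G] [Finite G] (n : ℕ) (hn : 0 < n) (x y : G)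
    (hx : orderOf x = n) (hy : orderOf y = n)
    (hprod : (↑(Subgroup.zpowers x) * ↑(Subgroup.zpowers y) : Set G) = Set.univ)
    (hinter : Subgroup.zpowers x ⊓ Subgroup.zpowers y = ⊥)
    (α : G ≃* G) (hαx : α x = y) (hαy : α y = x)
    (p q : ℕ) (hp : p.Prime) (hq : q.Prime) (hpq : p ≠ q) (hpn : p ∣ n) (hqn : q ∣ n)
    (P : Sylow p G) (hPnormal : (P : Subgroup G).Normal)
    (hPnab : ¬ ∀ a ∈ (P : Subgroup G), ∀ b ∈ (P : Subgroup G), a * b = b * a)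
    (Q : Sylow q G) :
    ∀ a ∈ (Q : Subgroup G), ∀ b ∈ (P : Subgroup G), a * b = b * a := by
  have hpF : Fact p.Prime := ⟨hp⟩
  have hqF : Fact q.Prime := ⟨hq⟩
  have hidx : ¬ p ∣ (P : Subgroup G).index := Sylow.not_dvd_index P
  have hcop : Nat.Coprime p (P : Subgroup G).index := (Nat.Prime.coprime_iff_not_dvd hp).2 hidx
  have hmemP : ∀ (g : G) (s : ℕ), g ^ (p ^ s) = 1 → g ∈ (P : Subgroup G) := by
    intro g s hg
    refine aux_coprime_mem _ g (p ^ s) (P : Subgroup G).index (hcop.pow_left s) ?_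
      (Subgroup.pow_index_mem _ g)
    rw [hg]; exact one_mem _
  have hαP : ∀ (γ : G ≃* G) (g : G), g ∈ (P : Subgroup G) → γ g ∈ (P : Subgroup G) := by
    intro γ g hg
    obtain ⟨s, hs⟩ := P.isPGroup' ⟨g, hg⟩
    apply hmemP _ s
    rw [← map_pow]
    have : g ^ p ^ s = 1 := congrArg Subtype.val hs
    rw [this, map_one]
  have hcardG : Nat.card G = n * n := by
    have hc : Subgroup.IsComplement' (Subgroup.zpowers x) (Subgroup.zpowers y) :=
      Subgroup.isComplement'_of_disjoint_and_mul_eq_univ (disjoint_iff.2 hinter) hprod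
    have := hc.card_mul_card
    rw [← this, Nat.card_zpowers, Nat.card_zpowers, hx, hy]
  obtain ⟨e, m', hm', hne⟩ := Nat.exists_eq_pow_mul_and_not_dvd hn.ne' p hp.ne_one
  have hm'0 : m' ≠ 0 := by rintro rfl; simp at hm'
  have hcardP : Nat.card P = p ^ e * p ^ e := by
    rw [Sylow.card_eq_multiplicity, hcardG, ← pow_add]
    congr 1
    rw [Nat.factorization_mul hn.ne' hn.ne', hne]
    simp [Nat.factorization_mul, hp.ne_zero, hm'0, hp.factorization_self,
      Nat.factorization_eq_zero_of_not_dvd hm']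
  have hpow : ∀ z : G, orderOf z = n → orderOf (z ^ m') = p ^ e := by
    intro z hz
    rw [orderOf_pow, hz, hne, Nat.gcd_eq_right (Dvd.intro_left _ rfl)]
    exact Nat.mul_div_cancel _ (Nat.pos_of_ne_zero hm'0)
  have hmem : ∀ z : G, orderOf z = n → z ^ m' ∈ (P : Subgroup G) := by
    intro z hz
    apply hmemP _ e
    rw [← hpow z hz, pow_orderOf_eq_one]
  let a : (P : Subgroup G) := ⟨x ^ m', hmem x hx⟩
  let b : (P : Subgroup G) := ⟨y ^ m', hmem y hy⟩
  have hab : ∀ g : (P : Subgroup G), ∃ i j : ℤ, g = a ^ i * b ^ j := by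
    let f : Subgroup.zpowers a × Subgroup.zpowers b → (P : Subgroup G) := fun t => t.1.1 * t.2.1
    have hf : Function.Bijective f := by
      rw [Nat.bijective_iff_injective_and_card]
      constructor
      · have hdis : Disjoint (Subgroup.zpowers a) (Subgroup.zpowers b) := by
          rw [Subgroup.disjoint_def]
          rintro _ ⟨i, rfl⟩ ⟨j, hj⟩
          have hj' : (y ^ m') ^ j = (x ^ m') ^ i := congrArg Subtype.val hj
          have : (x ^ m') ^ i ∈ Subgroup.zpowers x ⊓ Subgroup.zpowers y := by
            refine ⟨zpow_mem (pow_mem (Subgroup.mem_zpowers x) _) _, ?_⟩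
            rw [← hj']
            exact zpow_mem (pow_mem (Subgroup.mem_zpowers y) _) _
          rw [hinter, Subgroup.mem_bot] at this
          exact Subtype.ext this
        exact Subgroup.mul_injective_of_disjoint hdis
      · rw [Nat.card_prod, Nat.card_zpowers, Nat.card_zpowers, hcardP,
          ← Subgroup.orderOf_coe a, ← Subgroup.orderOf_coe b, hpow x hx, hpow y hy]
    intro g
    obtain ⟨⟨⟨_, i, rfl⟩, ⟨_, j, rfl⟩⟩, h⟩ := hf.2 g
    exact ⟨i, j, h.symm⟩
  let β : (P : Subgroup G) ≃* (P : Subgroup G) :=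
    { toFun := fun g => ⟨α g, hαP α g g.2⟩
      invFun := fun g => ⟨α.symm g, hαP α.symm g g.2⟩
      left_inv := fun g => by simp
      right_inv := fun g => by simp
      map_mul' := fun g h => by ext; simp }
  have hβ : ∀ g : (P : Subgroup G), ((β g : (P : Subgroup G)) : G) = α g := fun g => rfl
  obtain ⟨r, m, hm, hnr⟩ := Nat.exists_eq_pow_mul_and_not_dvd hn.ne' q hq.ne_one
  let u : MulAut (P : Subgroup G) := MulAut.conjNormal (x ^ m)
  let v : MulAut (P : Subgroup G) := MulAut.conjNormal (y ^ m)
  have hv : ∀ g, v (β g) = β (u g) := by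
    intro g
    ext
    rw [hβ, MulAut.conjNormal_apply, MulAut.conjNormal_apply, hβ]
    simp [hαx]
  have hu1 : u = 1 := by
    refine aux_main (r := r) hpq P.isPGroup' a b hab ?_ β ?_ ?_ u v ?_ ?_ hv
      (P : Subgroup G).index hcop ?_
    · intro h
      apply hPnab
      intro g hg k hk
      exact congrArg Subtype.val (h ⟨g, hg⟩ ⟨k, hk⟩)
    · ext; rw [hβ]; simp [a, b, hαx]
    · ext; rw [hβ]; simp [a, b, hαy]
    · ext
      rw [MulAut.conjNormal_apply]
      change x ^ m * x ^ m' * (x ^ m)⁻¹ = x ^ m'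
      rw [← pow_add, add_comm, pow_add, mul_inv_cancel_right]
    · change (MulAut.conjNormal (x ^ m)) ^ (q ^ r) = 1
      rw [← map_pow, ← pow_mul, mul_comm, ← hnr, ← hx, pow_orderOf_eq_one, map_one]
    · intro g
      have h1 : (u * v⁻¹) ^ (P : Subgroup G).index =
          MulAut.conjNormal ((x ^ m * (y ^ m)⁻¹) ^ (P : Subgroup G).index) := by
        rw [map_pow, map_mul, map_inv]
      have h2 := Subgroup.pow_index_mem (P : Subgroup G) (x ^ m * (y ^ m)⁻¹)
      rw [h1]
      set t := (x ^ m * (y ^ m)⁻¹) ^ (P : Subgroup G).index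
      have h3 : g⁻¹ * (MulAut.conjNormal t : MulAut (P : Subgroup G)) g = ⁅g⁻¹, ⟨t, h2⟩⁆ := by
        ext
        simp [commutatorElement_def, mul_assoc]
      rw [h3]
      exact Subgroup.commutator_mem_commutator (Subgroup.mem_top _) (Subgroup.mem_top _)
  have hv1 : v = 1 := by
    ext1 g
    obtain ⟨g, rfl⟩ := β.surjective g
    rw [hv, hu1]; rfl
  let C : Subgroup G := (MulAut.conjNormal : G →* MulAut (P : Subgroup G)).ker
  have hCi : C.index ∣ m * m := aux_index x y hprod C m hu1 hv1
  have hqC : Nat.Coprime q C.index := by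
    have h1 : Nat.Coprime q m := (Nat.Prime.coprime_iff_not_dvd hq).2 hm
    exact Nat.Coprime.coprime_dvd_right hCi (h1.mul_right h1)
  intro g hg h hh
  have hgC : g ∈ C := by
    obtain ⟨s, hs⟩ := Q.isPGroup' ⟨g, hg⟩
    have hs' : g ^ q ^ s = 1 := congrArg Subtype.val hs
    refine aux_coprime_mem C g (q ^ s) C.index (hqC.pow_left s) ?_ (Subgroup.pow_index_mem _ g)
    rw [hs']; exact one_mem _
  have h1 : (MulAut.conjNormal g : MulAut (P : Subgroup G)) = 1 := hgC
  have h2 : ((MulAut.conjNormal g : MulAut (P : Subgroup G)) ⟨h, hh⟩ : G) = h := by rw [h1]; rfl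
  rw [MulAut.conjNormal_apply] at h2
  exact mul_inv_eq_iff_eq_mul.1 h2
end
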